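/- arXiv:1310.7608 — 4 statements merged into one kernel-verified Lean document; each statement's English description precedes it below -/
import Mathlib

section
/- Let p be a prime and let R = ℤ[x_{ij} : 1 ≤ i ≤ p, j ∈ ℕ]. Let g ∈ R be fixed by every row permutation τ ∈ S_p (acting by τ(x_{ij}) = x_{τ(i)j}). Suppose that every monomial x^u occurring in g with nonzero coefficient satisfies Σ_{i=1}^p u_{ij} ≤ 1 for every column j ∈ ℕ, and that the constant coefficient of g is 0. Let η : R → ℤ[t_j : j ∈ ℕ] be the ring homomorphism determined by η(x_{ij}) = t_j. Then η(g) is divisible by p in ℤ[t_j : j ∈ ℕ]. -/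
open MvPolynomial

/-- The chain rule for the substitution that forgets the row index of each variable. -/
theorem pderiv_rename_snd {ι κ R : Type*} [Fintype ι] [CommSemiring R]
    (g : MvPolynomial (ι × κ) R) (j : κ) :
    pderiv j (rename Prod.snd g) = ∑ i : ι, rename Prod.snd (pderiv (i, j) g) := by
  classical
  induction g using MvPolynomial.induction_on with
  | C a => simp
  | add f g hf hg => simp [hf, hg, Finset.sum_add_distrib]
  | mul_X f q hf =>
    obtain ⟨k, l⟩ := q
    have hX (i : ι) : rename Prod.snd (pderiv (i, j) (X (k, l) : MvPolynomial (ι × κ) R)) =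
        if k = i then pderiv j (X l) else 0 := by
      by_cases hk : k = i <;> by_cases hl : l = j <;> simp [pderiv_X, hk, hl]
    simp only [map_mul, rename_X, pderiv_mul, hf, map_add, hX, Finset.sum_add_distrib,
      Finset.sum_mul, ← Finset.mul_sum, Finset.sum_ite_eq, Finset.mem_univ, if_true]

theorem mapDomain_snd_apply {ι κ M : Type*} [Fintype ι] [AddCommMonoid M]
    (u : ι × κ →₀ M) (j : κ) :
    u.mapDomain Prod.snd j = ∑ i : ι, u (i, j) := by
  classical
  induction u using Finsupp.induction_linear with
  | zero => simp
  | add f g hf hg => simp [Finsupp.mapDomain_add, hf, hg, Finset.sum_add_distrib]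
  | single q a =>
    obtain ⟨k, l⟩ := q
    by_cases hl : l = j <;> simp [Finsupp.mapDomain_single, Finsupp.single_apply, hl]

/-- For a row-symmetric polynomial, all rows contribute equally to the derivative of its image
under the map forgetting row indices. -/
theorem card_dvd_pderiv_rename_snd {ι κ R : Type*} [Fintype ι] [CommSemiring R]
    (g : MvPolynomial (ι × κ) R)
    (hsym : ∀ τ : Equiv.Perm ι, rename (fun q : ι × κ => (τ q.1, q.2)) g = g) (j : κ) :
    (Fintype.card ι : MvPolynomial κ R) ∣ pderiv j (rename Prod.snd g) := by
  classical
  have heq (i k : ι) : rename Prod.snd (pderiv (i, j) g) = rename Prod.snd (pderiv (k, j) g) := by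
    set e : ι × κ → ι × κ := fun q => (Equiv.swap i k q.1, q.2) with he
    have hinj : Function.Injective e := fun a b hab => by
      simpa [he, Prod.ext_iff] using hab
    have h := pderiv_rename hinj (k, j) g
    rw [hsym (Equiv.swap i k)] at h
    simp only [he, Equiv.swap_apply_right] at h
    rw [h, rename_rename]
    rfl
  rw [pderiv_rename_snd]
  rcases isEmpty_or_nonempty ι with _ | ⟨⟨k⟩⟩
  · simp
  · rw [Finset.sum_congr rfl fun i _ => heq i k, Finset.sum_const, Finset.card_univ,
      nsmul_eq_mul]
    exact dvd_mul_right _ _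

/-- Let `p` be a prime and `R = ℤ[x_{ij} : 1 ≤ i ≤ p, j ∈ ℕ]`. If
`g ∈ R` is fixed by every row permutation, every monomial occurring in `g` has degree at
most `1` in each column, and `g` has zero constant coefficient, then the image of `g` under
the homomorphism `η : R → ℤ[t_j : j ∈ ℕ]`, `x_{ij} ↦ t_j`, is divisible by `p`. -/
theorem eta_dvd_of_rowSymmetric
    (p : ℕ) (hp : p.Prime) (g : MvPolynomial (Fin p × ℕ) ℤ)
    (hsym : ∀ τ : Equiv.Perm (Fin p),
      rename (fun q : Fin p × ℕ => (τ q.1, q.2)) g = g)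
    (hcol : ∀ u ∈ g.support, ∀ j : ℕ, (∑ i : Fin p, u (i, j)) ≤ 1)
    (hconst : MvPolynomial.coeff 0 g = 0) :
    (p : MvPolynomial ℕ ℤ) ∣ rename (fun q : Fin p × ℕ => q.2) g := by
  rw [← map_natCast (C : ℤ →+* MvPolynomial ℕ ℤ), C_dvd_iff_dvd_coeff]
  intro d
  by_cases hd : coeff d (rename (fun q : Fin p × ℕ => q.2) g) = 0
  · simp [hd]
  obtain ⟨u, rfl, hu⟩ := coeff_rename_ne_zero _ _ _ hd
  set d := u.mapDomain Prod.snd with hdef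
  have hle (j : ℕ) : d j ≤ 1 := by
    rw [hdef, mapDomain_snd_apply]
    exact hcol u (mem_support_iff.2 hu) j
  obtain ⟨j, hj⟩ : ∃ j, d j ≠ 0 := by
    by_contra! h
    refine hu ?_
    have : u = 0 := by
      ext ⟨i, j⟩
      have hsum := h j
      rw [hdef, mapDomain_snd_apply, Finset.sum_eq_zero_iff] at hsum
      exact hsum i (Finset.mem_univ i)
    rw [this, hconst]
  have hj1 : d j = 1 := le_antisymm (hle j) (Nat.one_le_iff_ne_zero.2 hj)
  have hdvd := card_dvd_pderiv_rename_snd g hsym j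
  rw [Fintype.card_fin, ← map_natCast (C : ℤ →+* MvPolynomial ℕ ℤ), C_dvd_iff_dvd_coeff] at hdvd
  have hc := hdvd (d - Finsupp.single j 1)
  rw [coeff_pderiv, tsub_add_cancel_of_le (Finsupp.single_le_iff.2 hj1.ge)] at hc
  simpa [hj1] using hc
end

section
/- Let K be a field of characteristic 0, or of characteristic p > n. View R_n as a module over its subalgebra R̄_n. Then every Sym(ℕ)-invariant R̄_n-submodule M of R_n (meaning σ(M) = M for all σ ∈ Sym(ℕ)) is finitely generated as a Sym(ℕ)-invariant R̄_n-submodule: there is a finite set B ⊆ M such that M is the R̄_n-submodule of R_n generated by the orbit {σ(b) : σ ∈ Sym(ℕ), b ∈ B}. -/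
open MvPolynomial

/-- The action of a permutation `σ` of the column index set `ℕ` on the polynomial ring
`R_n = K[x_{ij} : 1 ≤ i ≤ n, j ∈ ℕ]`, given by `σ(x_{ij}) = x_{i σ(j)}`. -/
noncomputable def colPerm (K : Type*) [CommSemiring K] (n : ℕ) (σ : Equiv.Perm ℕ) :
    MvPolynomial (Fin n × ℕ) K →ₐ[K] MvPolynomial (Fin n × ℕ) K :=
  rename (fun q => (q.1, σ q.2))

/-- The action of a permutation `τ ∈ S_n` of the row index set on
`R_n = K[x_{ij} : 1 ≤ i ≤ n, j ∈ ℕ]`, given by `τ(x_{ij}) = x_{τ(i) j}`. -/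
noncomputable def rowPerm (K : Type*) [CommSemiring K] (n : ℕ) (τ : Equiv.Perm (Fin n)) :
    MvPolynomial (Fin n × ℕ) K →ₐ[K] MvPolynomial (Fin n × ℕ) K :=
  rename (fun q => (τ q.1, q.2))

/-- The subalgebra `R̄_n ⊆ R_n` of polynomials symmetric under all row permutations. -/
noncomputable def symAlg (K : Type*) [CommSemiring K] (n : ℕ) :
    Subalgebra K (MvPolynomial (Fin n × ℕ) K) where
  carrier := {f | ∀ τ : Equiv.Perm (Fin n), rowPerm K n τ f = f}
  mul_mem' := fun {a b} ha hb => fun τ => by rw [map_mul, ha τ, hb τ]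
  add_mem' := fun {a b} ha hb => fun τ => by rw [map_add, ha τ, hb τ]
  algebraMap_mem' := fun r => fun τ => by simp [rowPerm]

lemma rowPerm_colPerm (K : Type*) [CommSemiring K] (n : ℕ) (σ : Equiv.Perm ℕ)
    (τ : Equiv.Perm (Fin n)) (f : MvPolynomial (Fin n × ℕ) K) :
    rowPerm K n τ (colPerm K n σ f) = colPerm K n σ (rowPerm K n τ f) := by
  simp only [rowPerm, colPerm, rename_rename]
  rfl

lemma colPerm_mem_symAlg (K : Type*) [CommSemiring K] (n : ℕ) (σ : Equiv.Perm ℕ)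
    {f : MvPolynomial (Fin n × ℕ) K} (hf : f ∈ symAlg K n) :
    colPerm K n σ f ∈ symAlg K n := by
  intro τ
  rw [rowPerm_colPerm, hf τ]

/-- The action of `σ ∈ Sym(ℕ)` restricted to the symmetric subalgebra `R̄_n`. -/
noncomputable def colPermBar (K : Type*) [CommSemiring K] (n : ℕ) (σ : Equiv.Perm ℕ) :
    symAlg K n →ₐ[K] symAlg K n :=
  ((colPerm K n σ).comp (symAlg K n).val).codRestrict (symAlg K n)
    (fun x => colPerm_mem_symAlg K n σ x.2)

/-- `h_k = Σ_{i=1}^n x_{i1} ⋯ x_{ik}` (with the first `k` columns indexed by `0,…,k-1`). -/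
noncomputable def hPoly (K : Type*) [CommSemiring K] (n k : ℕ) : MvPolynomial (Fin n × ℕ) K :=
  ∑ i : Fin n, ∏ j ∈ Finset.range k, X (i, j)

lemma hPoly_mem_symAlg (K : Type*) [CommSemiring K] (n k : ℕ) : hPoly K n k ∈ symAlg K n := by
  intro τ
  simp only [hPoly, rowPerm, map_sum, map_prod, rename_X]
  exact Equiv.sum_comp τ (fun i => ∏ j ∈ Finset.range k, (X (i, j) : MvPolynomial (Fin n × ℕ) K))

/-- `h_k` as an element of the symmetric subalgebra `R̄_n`. -/
noncomputable def hBar (K : Type*) [CommSemiring K] (n k : ℕ) : symAlg K n :=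
  ⟨hPoly K n k, hPoly_mem_symAlg K n k⟩

/-- Let `E` be a set of endomorphisms of a space with a well-ordered basis. If the basis is well
quasi-ordered by the strictly monotone basis maps induced by members of `E`, then every `E`-stable
subspace is finitely generated as an `E`-stable subspace. -/
theorem Module.Basis.exists_finset_forall_stable_le {K V T : Type*} [Field K] [AddCommGroup V]
    [Module K V] [LinearOrder T] [WellFoundedLT T] (b : Module.Basis T K V) (E : Set (V →ₗ[K] V))
    {q : T → T → Prop} (hq : WellQuasiOrdered q)
    (hqE : ∀ s t, q s t → ∃ L ∈ E, ∃ l : T → T, StrictMono l ∧ (∀ u, L (b u) = b (l u)) ∧ l s = t)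
    (N : Submodule K V) (hN : ∀ L ∈ E, ∀ v ∈ N, L v ∈ N) :
    ∃ B : Finset V, (B : Set V) ⊆ N ∧
      ∀ N' : Submodule K V, (∀ L ∈ E, ∀ v ∈ N', L v ∈ N') → (B : Set V) ⊆ N' → N ≤ N' := by
  classical
  by_contra! hcon
  let lead : V → WithBot T := fun v => (b.repr v).support.max
  obtain ⟨f, hf, hlt⟩ := exists_seq_of_forall_finset_exists
    (fun x : V × Submodule K V => x.1 ∈ N ∧ x.1 ∉ x.2 ∧ (∀ L ∈ E, ∀ v ∈ x.2, L v ∈ x.2) ∧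
      ∀ g ∈ N, g ∉ x.2 → ¬ lead g < lead x.1)
    (fun x y => x.1 ∈ y.2) (by
      intro s hs
      obtain ⟨N', hE, hB, hle⟩ := hcon (s.image Prod.fst) (by
        intro v hv
        obtain ⟨x, hx, rfl⟩ := Finset.mem_image.1 (Finset.mem_coe.1 hv)
        exact (hs x hx).1)
      obtain ⟨v, hv, hv'⟩ := SetLike.not_le_iff_exists.1 hle
      obtain ⟨w, ⟨hw, hw'⟩, hmin⟩ := (InvImage.wf lead (wellFounded_lt (α := WithBot T))).has_min
        {w | w ∈ N ∧ w ∉ N'} ⟨v, hv, hv'⟩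
      exact ⟨(w, N'), ⟨hw, hw', hE, fun g hg hg' => hmin g ⟨hg, hg'⟩⟩,
        fun x hx => hB (Finset.mem_coe.2 (Finset.mem_image_of_mem _ hx))⟩)
  have hne : ∀ k, (b.repr (f k).1).support.Nonempty := by
    intro k
    rw [Finsupp.support_nonempty_iff, ne_eq, LinearEquiv.map_eq_zero_iff]
    intro h0
    exact (hf k).2.1 (h0 ▸ zero_mem _)
  let t : ℕ → T := fun k => (b.repr (f k).1).support.max' (hne k)
  have ht : ∀ k, lead (f k).1 = t k := fun k => (Finset.coe_max' (hne k)).symm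
  have htop : ∀ k u, b.repr (f k).1 u ≠ 0 → u ≤ t k := fun k u hu =>
    Finset.le_max' _ _ (Finsupp.mem_support_iff.2 hu)
  have hcoef : ∀ k, b.repr (f k).1 (t k) ≠ 0 := fun k =>
    Finsupp.mem_support_iff.1 (Finset.max'_mem _ (hne k))
  obtain ⟨i, j, hij, hqij⟩ := hq t
  obtain ⟨L, hL, l, hl, hLb, hlt'⟩ := hqE _ _ hqij
  have hrepr : ∀ v, b.repr (L v) = Finsupp.mapDomain l (b.repr v) := by
    intro v
    have : b.repr.toLinearMap ∘ₗ L = Finsupp.lmapDomain K K l ∘ₗ b.repr.toLinearMap :=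
      b.ext fun u => by simp [hLb]
    exact LinearMap.congr_fun this v
  set c := b.repr (f j).1 (t j) / b.repr (f i).1 (t i) with hc
  have hLi : L (f i).1 ∈ (f j).2 := (hf j).2.2.1 L hL _ (hlt i j hij)
  refine (hf j).2.2.2 ((f j).1 - c • L (f i).1)
    (sub_mem (hf j).1 (Submodule.smul_mem _ _ (hN L hL _ (hf i).1))) (fun h => ?_) ?_
  · exact (hf j).2.1 ((Submodule.sub_mem_iff_left _ (Submodule.smul_mem _ _ hLi)).1 h)
  · rw [ht j]
    refine (Finset.sup_lt_iff (WithBot.bot_lt_coe _)).2 fun u hu => WithBot.coe_lt_coe.2 ?_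
    rw [Finsupp.mem_support_iff] at hu
    contrapose! hu
    rw [map_sub, map_smul, hrepr, Finsupp.sub_apply, Finsupp.smul_apply]
    rcases hu.eq_or_lt with rfl | hu
    · rw [← hlt', Finsupp.mapDomain_apply hl.injective, hlt', hc, smul_eq_mul,
        div_mul_cancel₀ _ (hcoef i), sub_self]
    · have h1 : b.repr (f j).1 u = 0 := by
        by_contra h
        exact (htop j u h).not_gt hu
      have h2 : Finsupp.mapDomain l (b.repr (f i).1) u = 0 := by
        by_cases hr : u ∈ Set.range l
        · obtain ⟨s, rfl⟩ := hr
          rw [Finsupp.mapDomain_apply hl.injective]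
          by_contra h
          have := hl.monotone (htop i s h)
          rw [hlt'] at this
          exact this.not_gt hu
        · exact Finsupp.mapDomain_of_notMem_range _ _ hr
      rw [h1, h2, smul_zero, sub_zero]

/-- Higman's lemma for finitely supported families of columns. -/
theorem wellQuasiOrdered_orderEmbedding (ι : Type*) [Finite ι] :
    WellQuasiOrdered fun a a' : ι × ℕ →₀ ℕ =>
      ∃ φ : ℕ ↪o ℕ, ∀ r k, a (r, k) ≤ a' (r, φ k) := by
  classical
  intro s
  have hw : ∀ a : ι × ℕ →₀ ℕ, ∃ w : ℕ, ∀ r k, w ≤ k → a (r, k) = 0 := by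
    intro a
    refine ⟨(a.support.image Prod.snd).sup id + 1, fun r k hk => ?_⟩
    by_contra h
    have : k ≤ (a.support.image Prod.snd).sup id :=
      Finset.le_sup (f := id) (Finset.mem_image.2 ⟨(r, k), Finsupp.mem_support_iff.2 h, rfl⟩)
    omega
  choose w hw using hw
  let word : (ι × ℕ →₀ ℕ) → List (ι → ℕ) :=
    fun a => List.ofFn fun k : Fin (w a) => fun r => a (r, k)
  have hpwo := Set.PartiallyWellOrderedOn.partiallyWellOrderedOn_sublistForall₂
    ((· ≤ ·) : (ι → ℕ) → (ι → ℕ) → Prop) (s := Set.univ)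
    (Set.isPWO_of_wellQuasiOrderedLE _)
  simp only [Set.mem_univ, implies_true, Set.ofPred_true] at hpwo
  obtain ⟨i, j, hij, h⟩ := Set.partiallyWellOrderedOn_univ_iff.1 hpwo fun k => word (s k)
  obtain ⟨m, hm, hsub⟩ := List.sublistForall₂_iff.1 h
  obtain ⟨φ, hφ⟩ := List.sublist_iff_exists_orderEmbedding_getElem?_eq.1 hsub
  refine ⟨i, j, hij, φ, fun r k => ?_⟩
  by_cases hk : w (s i) ≤ k
  · simp [hw _ r k hk]
  have hk1 : k < (word (s i)).length := by simpa [word] using hk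
  have hk2 : k < m.length := hm.length_eq ▸ hk1
  have h1 := hm.get hk1 hk2
  have h2 := hφ k
  rw [List.getElem?_eq_getElem hk2, eq_comm, List.getElem?_eq_some_iff] at h2
  obtain ⟨h3, h4⟩ := h2
  rw [List.get_eq_getElem, List.get_eq_getElem, ← h4] at h1
  simpa [word] using h1 r

/-- The variables of `R_n`, ordered first by column and then by row. -/
def colKey (n : ℕ) : Fin n × ℕ ≃ ℕ ×ₗ Fin n := (Equiv.prodComm _ _).trans toLex

theorem colKey_strictMono {n : ℕ} {φ : ℕ → ℕ} (hφ : StrictMono φ) (q r : Fin n × ℕ) :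
    colKey n (q.1, φ q.2) < colKey n (r.1, φ r.2) ↔ colKey n q < colKey n r := by
  simp [colKey, Prod.Lex.toLex_lt_toLex, hφ.lt_iff_lt, hφ.injective.eq_iff]

/-- The exponent `a` as an element of the colexicographic monomial order. -/
noncomputable def monoRank {n : ℕ} (a : Fin n × ℕ →₀ ℕ) : Colex ((ℕ ×ₗ Fin n) →₀ ℕ) :=
  toColex (Finsupp.equivMapDomain (colKey n) a)

theorem monoRank_injective {n : ℕ} : Function.Injective (monoRank (n := n)) :=
  toColex.injective.comp (Finsupp.equivCongrLeft (colKey n)).injective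

theorem monoRank_lt_iff {n : ℕ} {a b : Fin n × ℕ →₀ ℕ} :
    monoRank a < monoRank b ↔
      ∃ q, (∀ r, colKey n q < colKey n r → a r = b r) ∧ a q < b q := by
  rw [Finsupp.Colex.lt_iff, ← (colKey n).exists_congr_right]
  refine exists_congr fun q => and_congr ?_ ?_
  · rw [← (colKey n).forall_congr_right]
    simp [monoRank]
  · simp [monoRank]

/-- The map on variables of `R_n` sending column `j` to column `φ j`. -/
def colMap {n : ℕ} (φ : ℕ → ℕ) (q : Fin n × ℕ) : Fin n × ℕ := (q.1, φ q.2)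

theorem colMap_injective {n : ℕ} {φ : ℕ → ℕ} (hφ : Function.Injective φ) :
    Function.Injective (colMap (n := n) φ) :=
  Function.injective_id.prodMap hφ

theorem monoRank_add_mapDomain_lt {n : ℕ} {φ : ℕ → ℕ} (hφ : StrictMono φ)
    (c : Fin n × ℕ →₀ ℕ) {a b : Fin n × ℕ →₀ ℕ} (h : monoRank a < monoRank b) :
    monoRank (c + a.mapDomain (colMap φ)) < monoRank (c + b.mapDomain (colMap φ)) := by
  obtain ⟨q, hq, hlt⟩ := monoRank_lt_iff.1 h
  have hinj := colMap_injective (n := n) hφ.injective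
  refine monoRank_lt_iff.2 ⟨colMap φ q, fun r hr => ?_, ?_⟩
  · simp only [Finsupp.add_apply]
    congr 1
    by_cases hmem : r ∈ Set.range (colMap (n := n) φ)
    · obtain ⟨r, rfl⟩ := hmem
      rw [Finsupp.mapDomain_apply hinj, Finsupp.mapDomain_apply hinj]
      exact hq r ((colKey_strictMono hφ q r).1 hr)
    · rw [Finsupp.mapDomain_of_notMem_range _ _ hmem, Finsupp.mapDomain_of_notMem_range _ _ hmem]
  · simpa [Finsupp.mapDomain_apply hinj] using hlt

/-- The map shifting columns along `φ` and multiplying by the monomial `c`, on every component. -/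
noncomputable def shiftMul (K : Type*) [Field K] (n : ℕ) (ι : Type*) (φ : ℕ → ℕ)
    (c : Fin n × ℕ →₀ ℕ) :
    (ι → MvPolynomial (Fin n × ℕ) K) →ₗ[K] (ι → MvPolynomial (Fin n × ℕ) K) :=
  LinearMap.pi fun i => LinearMap.mulLeft K (monomial c 1) ∘ₗ
    (rename (colMap φ)).toLinearMap ∘ₗ LinearMap.proj i

theorem shiftMul_apply {K : Type*} [Field K] {n : ℕ} {ι : Type*} (φ : ℕ → ℕ)
    (c : Fin n × ℕ →₀ ℕ) (v : ι → MvPolynomial (Fin n × ℕ) K) (i : ι) :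
    shiftMul K n ι φ c v i = monomial c 1 * rename (colMap φ) (v i) := rfl

theorem exists_finset_forall_shiftMul_stable_le (K : Type*) [Field K] (n : ℕ) (ι : Type*)
    [Finite ι] (N : Submodule K (ι → MvPolynomial (Fin n × ℕ) K))
    (hN : ∀ φ : ℕ → ℕ, StrictMono φ → ∀ c, ∀ v ∈ N, shiftMul K n ι φ c v ∈ N) :
    ∃ B : Finset (ι → MvPolynomial (Fin n × ℕ) K), (∀ v ∈ B, v ∈ N) ∧
      ∀ N' : Submodule K (ι → MvPolynomial (Fin n × ℕ) K),
        (∀ φ : ℕ → ℕ, StrictMono φ → ∀ c, ∀ v ∈ N', shiftMul K n ι φ c v ∈ N') →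
        (∀ v ∈ B, v ∈ N') → N ≤ N' := by
  classical
  have := Fintype.ofFinite ι
  let b := Pi.basis fun _ : ι => basisMonomials (Fin n × ℕ) K
  let e := Fintype.equivFin ι
  let rank : (Σ _ : ι, Fin n × ℕ →₀ ℕ) → Fin (Fintype.card ι) ×ₗ Colex ((ℕ ×ₗ Fin n) →₀ ℕ) :=
    fun t => toLex (e t.1, monoRank t.2)
  have hrank : Function.Injective rank := by
    rintro ⟨i, a⟩ ⟨j, c⟩ h
    obtain ⟨h1, h2⟩ := Prod.ext_iff.1 (toLex.injective h)
    obtain rfl := e.injective h1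
    obtain rfl := monoRank_injective h2
    rfl
  let order : LinearOrder (Σ _ : ι, Fin n × ℕ →₀ ℕ) := LinearOrder.lift' rank hrank
  have : @WellFoundedLT _ order.toLT := ⟨InvImage.wf rank wellFounded_lt⟩
  obtain ⟨B, hB, hle⟩ := b.exists_finset_forall_stable_le
    {L | ∃ φ : ℕ → ℕ, StrictMono φ ∧ ∃ c, L = shiftMul K n ι φ c}
    (q := fun s t => s.1 = t.1 ∧ ∃ φ : ℕ ↪o ℕ, ∀ r k, s.2 (r, k) ≤ t.2 (r, φ k)) (by
      intro f
      obtain ⟨i, j, hij, h⟩ := (Finite.wellQuasiOrdered (Eq : ι → ι → Prop)).prod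
        (wellQuasiOrdered_orderEmbedding (Fin n)) fun k => ((f k).1, (f k).2)
      exact ⟨i, j, hij, h⟩) (by
      rintro ⟨i, a⟩ ⟨j, a'⟩ ⟨h, φ, hφ⟩
      obtain rfl : i = j := h
      have hinj := colMap_injective (n := n) φ.injective
      have hdiv : a.mapDomain (colMap φ) ≤ a' := by
        intro r
        by_cases hmem : r ∈ Set.range (colMap (n := n) φ)
        · obtain ⟨r, rfl⟩ := hmem
          rw [Finsupp.mapDomain_apply hinj]
          exact hφ r.1 r.2
        · simp [Finsupp.mapDomain_of_notMem_range _ _ hmem]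
      set c := a' - a.mapDomain (colMap φ) with hc
      refine ⟨shiftMul K n ι φ c, ⟨φ, φ.strictMono, c, rfl⟩,
        fun t => ⟨t.1, c + t.2.mapDomain (colMap φ)⟩, ?_, ?_, ?_⟩
      · intro s t hst
        have hst' : rank s < rank t := hst
        change rank _ < rank _
        simp only [rank, Prod.Lex.toLex_lt_toLex] at hst' ⊢
        exact hst'.imp_right fun h => ⟨h.1, monoRank_add_mapDomain_lt φ.strictMono c h.2⟩
      · rintro ⟨k, u⟩
        ext1 m
        rw [shiftMul_apply]
        simp only [b, Pi.basis_apply, coe_basisMonomials]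
        by_cases hm : m = k
        · subst hm
          simp [rename_monomial, monomial_mul]
        · simp [Pi.single_eq_of_ne hm]
      · simp only [hc, tsub_add_cancel_of_le hdiv])
    N (by rintro _ ⟨φ, hφ, c, rfl⟩; exact hN φ hφ c)
  exact ⟨B, hB, fun N' hN' => hle N' (by rintro _ ⟨φ, hφ, c, rfl⟩; exact hN' φ hφ c)⟩

theorem exists_colPerm_eq_rename_colMap {K : Type*} [Field K] {n : ℕ} {φ : ℕ → ℕ}
    (hφ : Function.Injective φ) (f : MvPolynomial (Fin n × ℕ) K) :
    ∃ σ : Equiv.Perm ℕ, rename (colMap φ) f = colPerm K n σ f := by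
  classical
  obtain ⟨s, g, rfl⟩ := exists_finset_rename f
  let w := (s.image Prod.snd).sup id + 1
  have := Equiv.Perm.isMultiplyPretransitive ℕ w
  obtain ⟨σ, hσ⟩ := MulAction.exists_smul_eq (Equiv.Perm ℕ) (Fin.valEmbedding (n := w))
    (Fin.valEmbedding.trans ⟨φ, hφ⟩)
  refine ⟨σ, ?_⟩
  rw [colPerm, rename_rename, rename_rename]
  congr 1
  congr 1
  funext q
  have hq : q.1.2 < w := Nat.lt_succ_of_le
    (Finset.le_sup (f := id) (Finset.mem_image_of_mem Prod.snd q.2))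
  have h : σ q.1.2 = φ q.1.2 := DFunLike.congr_fun hσ ⟨q.1.2, hq⟩
  simp [colMap, h]

theorem colPerm_mul (K : Type*) [Field K] (n : ℕ) (σ ρ : Equiv.Perm ℕ)
    (f : MvPolynomial (Fin n × ℕ) K) :
    colPerm K n (σ * ρ) f = colPerm K n σ (colPerm K n ρ f) := by
  simp only [colPerm, rename_rename]
  rfl

theorem rowPerm_mul (K : Type*) [Field K] (n : ℕ) (τ ρ : Equiv.Perm (Fin n))
    (f : MvPolynomial (Fin n × ℕ) K) :
    rowPerm K n (τ * ρ) f = rowPerm K n τ (rowPerm K n ρ f) := by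
  simp only [rowPerm, rename_rename]
  rfl

theorem rowPerm_inv_apply_rowPerm (K : Type*) [Field K] (n : ℕ) (τ : Equiv.Perm (Fin n))
    (f : MvPolynomial (Fin n × ℕ) K) : rowPerm K n τ⁻¹ (rowPerm K n τ f) = f := by
  rw [← rowPerm_mul, inv_mul_cancel]
  exact rename_id_apply f

theorem sum_rowPerm_inv_mem_symAlg (K : Type*) [Field K] (n : ℕ)
    (f : MvPolynomial (Fin n × ℕ) K) : ∑ τ, rowPerm K n τ⁻¹ f ∈ symAlg K n := by
  intro ρ
  rw [map_sum]
  refine Fintype.sum_equiv (Equiv.mulRight ρ⁻¹) _ _ fun τ => ?_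
  rw [← rowPerm_mul, Equiv.coe_mulRight, mul_inv_rev, inv_inv]

/-- The tuple of all row permutations of `f`. -/
noncomputable def rowOrbit (K : Type*) [Field K] (n : ℕ) (f : MvPolynomial (Fin n × ℕ) K)
    (τ : Equiv.Perm (Fin n)) : MvPolynomial (Fin n × ℕ) K :=
  rowPerm K n τ f

theorem sum_rowPerm_inv_mem_span {K : Type*} [Field K] {n : ℕ}
    {S : Set (MvPolynomial (Fin n × ℕ) K)} {v : Equiv.Perm (Fin n) → MvPolynomial (Fin n × ℕ) K}
    (hv : v ∈ Submodule.span (MvPolynomial (Fin n × ℕ) K) (rowOrbit K n '' S))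
    (r : MvPolynomial (Fin n × ℕ) K) :
    ∑ τ, rowPerm K n τ⁻¹ (r * v τ) ∈ Submodule.span (symAlg K n) S := by
  induction hv using Submodule.span_induction generalizing r with
  | mem x hx =>
    obtain ⟨y, hy, rfl⟩ := hx
    have h : ∑ τ, rowPerm K n τ⁻¹ (r * rowOrbit K n y τ) =
        (⟨_, sum_rowPerm_inv_mem_symAlg K n r⟩ : symAlg K n) • y := by
      simp only [rowOrbit, map_mul, rowPerm_inv_apply_rowPerm, ← Finset.sum_mul]
      rfl
    rw [h]
    exact Submodule.smul_mem _ _ (Submodule.subset_span hy)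
  | zero => simp
  | add x y _ _ hx hy =>
    simp only [Pi.add_apply, mul_add, map_add, Finset.sum_add_distrib]
    exact add_mem (hx r) (hy r)
  | smul a x _ hx =>
    simp only [Pi.smul_apply, smul_eq_mul, ← mul_assoc]
    exact hx (r * a)

theorem mem_span_of_rowOrbit_mem_span {K : Type*} [Field K] {n : ℕ}
    (hn : (n.factorial : K) ≠ 0) {S : Set (MvPolynomial (Fin n × ℕ) K)}
    {f : MvPolynomial (Fin n × ℕ) K}
    (hf : rowOrbit K n f ∈ Submodule.span (MvPolynomial (Fin n × ℕ) K) (rowOrbit K n '' S)) :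
    f ∈ Submodule.span (symAlg K n) S := by
  have h := sum_rowPerm_inv_mem_span hf 1
  simp only [rowOrbit, one_mul, rowPerm_inv_apply_rowPerm, Finset.sum_const, Finset.card_univ,
    Fintype.card_perm, Fintype.card_fin] at h
  have h' := Submodule.smul_of_tower_mem _ (n.factorial : K)⁻¹ h
  rwa [← Nat.cast_smul_eq_nsmul K, inv_smul_smul₀ hn] at h'

theorem shiftMul_mem_span_rowOrbit {K : Type*} [Field K] {n : ℕ}
    {S : Set (MvPolynomial (Fin n × ℕ) K)} (hS : ∀ σ : Equiv.Perm ℕ, ∀ f ∈ S, colPerm K n σ f ∈ S)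
    {φ : ℕ → ℕ} (hφ : StrictMono φ) (c : Fin n × ℕ →₀ ℕ)
    {v : Equiv.Perm (Fin n) → MvPolynomial (Fin n × ℕ) K}
    (hv : v ∈ Submodule.span (MvPolynomial (Fin n × ℕ) K) (rowOrbit K n '' S)) :
    shiftMul K n _ φ c v ∈
      Submodule.span (MvPolynomial (Fin n × ℕ) K) (rowOrbit K n '' S) := by
  induction hv using Submodule.span_induction with
  | mem x hx =>
    obtain ⟨y, hy, rfl⟩ := hx
    obtain ⟨σ, hσ⟩ := exists_colPerm_eq_rename_colMap hφ.injective y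
    have h : shiftMul K n _ φ c (rowOrbit K n y) =
        (monomial c 1 : MvPolynomial (Fin n × ℕ) K) • rowOrbit K n (colPerm K n σ y) := by
      funext τ
      rw [shiftMul_apply, Pi.smul_apply, smul_eq_mul, rowOrbit, rowOrbit, ← hσ, rowPerm,
        rename_rename, rename_rename]
      rfl
    rw [h]
    exact Submodule.smul_mem _ _ (Submodule.subset_span ⟨_, hS σ y hy, rfl⟩)
  | zero => simp
  | add x y _ _ hx hy => simpa only [map_add] using add_mem hx hy
  | smul a x _ hx =>
    have h : shiftMul K n _ φ c (a • x) = rename (colMap φ) a • shiftMul K n _ φ c x := by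
      funext τ
      simp only [shiftMul_apply, Pi.smul_apply, smul_eq_mul, map_mul]
      ring
    rw [h]
    exact Submodule.smul_mem _ _ hx

theorem natCast_factorial_ne_zero_of_charP (K : Type*) [Field K] (n p : ℕ) [CharP K p]
    (hp : p = 0 ∨ n < p) : (n.factorial : K) ≠ 0 := by
  rw [ne_eq, CharP.cast_eq_zero_iff K p]
  rcases CharP.char_is_prime_or_zero K p with hprime | rfl
  · rw [hprime.dvd_factorial]
    have := hprime.pos
    omega
  · simpa using n.factorial_ne_zero

/-- Krasilnikov, 1992; module version. If `K` has characteristic `0` or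
characteristic `p > n`, then every `Sym(ℕ)`-invariant `R̄_n`-submodule of `R_n` is finitely
generated as a `Sym(ℕ)`-invariant `R̄_n`-submodule. -/
theorem symInvariant_submodule_fg_of_large_char
    (K : Type) [Field K] (n : ℕ) (hn : 1 ≤ n) (p : ℕ) [CharP K p] (hp : p = 0 ∨ n < p)
    (M : Submodule (symAlg K n) (MvPolynomial (Fin n × ℕ) K))
    (hM : ∀ σ : Equiv.Perm ℕ, (colPerm K n σ) '' (M : Set (MvPolynomial (Fin n × ℕ) K)) = M) :
    ∃ B : Finset (MvPolynomial (Fin n × ℕ) K), (↑B : Set (MvPolynomial (Fin n × ℕ) K)) ⊆ M ∧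
      M = Submodule.span (symAlg K n)
        {y | ∃ σ : Equiv.Perm ℕ, ∃ b ∈ B, y = colPerm K n σ b} := by
  classical
  have hMσ : ∀ σ : Equiv.Perm ℕ, ∀ f ∈ (M : Set _), colPerm K n σ f ∈ (M : Set _) :=
    fun σ f hf => hM σ ▸ Set.mem_image_of_mem _ hf
  let N := Submodule.span (MvPolynomial (Fin n × ℕ) K)
    (rowOrbit K n '' (M : Set (MvPolynomial (Fin n × ℕ) K)))
  obtain ⟨C, hCN, hC⟩ := exists_finset_forall_shiftMul_stable_le K n (Equiv.Perm (Fin n))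
    (N.restrictScalars K) fun φ hφ c v hv => shiftMul_mem_span_rowOrbit hMσ hφ c hv
  have hfin : ∀ v : C, ∃ B : Finset (MvPolynomial (Fin n × ℕ) K),
      (B : Set (MvPolynomial (Fin n × ℕ) K)) ⊆ M ∧
      v.1 ∈ Submodule.span (MvPolynomial (Fin n × ℕ) K)
        (rowOrbit K n '' (B : Set (MvPolynomial (Fin n × ℕ) K))) := by
    intro v
    obtain ⟨T, hT, hv⟩ := Submodule.mem_span_finite_of_mem_span (hCN v.1 v.2)
    obtain ⟨B, hB, rfl⟩ := Finset.subset_set_image_iff.1 hT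
    exact ⟨B, hB, by simpa using hv⟩
  choose F hFM hF using hfin
  let B := Finset.univ.biUnion F
  have hBM : (B : Set (MvPolynomial (Fin n × ℕ) K)) ⊆ M := by
    intro f hf
    obtain ⟨v, -, hv⟩ := Finset.mem_biUnion.1 (Finset.mem_coe.1 hf)
    exact hFM v hv
  refine ⟨B, hBM, le_antisymm (fun f hf => ?_) (Submodule.span_le.2 ?_)⟩
  · refine mem_span_of_rowOrbit_mem_span (natCast_factorial_ne_zero_of_charP K n p hp)
      (hC (Submodule.restrictScalars K (Submodule.span _ _)) (fun φ hφ c v hv => ?_)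
        (fun v hv => ?_) (Submodule.subset_span (Set.mem_image_of_mem _ hf)))
    · refine shiftMul_mem_span_rowOrbit ?_ hφ c hv
      rintro σ _ ⟨ρ, b, hb, rfl⟩
      exact ⟨σ * ρ, b, hb, (colPerm_mul K n σ ρ b).symm⟩
    · refine Submodule.span_mono (Set.image_mono fun b hb => ?_) (hF ⟨v, hv⟩)
      exact ⟨1, b, Finset.mem_biUnion.2 ⟨⟨v, hv⟩, Finset.mem_univ _, hb⟩, (rename_id_apply b).symm⟩
  · rintro _ ⟨σ, b, hb, rfl⟩
    exact hMσ σ b (hBM hb)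
end

section
/- Let M be the free metabelian group on free generators { x_i : i ∈ ℕ }, i.e., the quotient of the free group on { x_i : i ∈ ℕ } by the second derived subgroup (the commutator subgroup of the commutator subgroup). The group Sym(ℕ) acts on M by automorphisms via σ(x_i) = x_{σ(i)}. Then every Sym(ℕ)-invariant normal subgroup N of M (σ(N) = N for all σ ∈ Sym(ℕ)) is finitely generated as a Sym(ℕ)-invariant normal subgroup: there is a finite set B ⊆ N such that N equals the normal closure in M of the orbit {σ(b) : σ ∈ Sym(ℕ), b ∈ B}. -/
/-- The free metabelian group on free generators `x_i` (`i ∈ ℕ`): the quotient of the free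
group on `ℕ` by its second derived subgroup. -/
abbrev FreeMetabelianGroup : Type :=
  FreeGroup ℕ ⧸ derivedSeries (FreeGroup ℕ) 2

instance : (derivedSeries (FreeGroup ℕ) 2).Normal :=
  derivedSeries_normal _ _

/-- The automorphism of the free metabelian group induced by a permutation `σ` of the free
generators, `σ(x_i) = x_{σ(i)}`. -/
noncomputable def permFM (σ : Equiv.Perm ℕ) : FreeMetabelianGroup →* FreeMetabelianGroup :=
  QuotientGroup.map _ _ (FreeGroup.map σ)
    ((Subgroup.map_le_iff_le_comap).mp
      (map_derivedSeries_le_derivedSeries (FreeGroup.map σ) 2))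

theorem Int.exists_natAbs_sub_mul_lt {a b : ℤ} (hb : b ≠ 0)
    (h : b.natAbs ≤ a.natAbs) : ∃ ε : ℤ, (a - ε * b).natAbs < a.natAbs := by
  by_cases hab : 0 < a ↔ 0 < b
  · exact ⟨1, by omega⟩
  · exact ⟨-1, by omega⟩

section Noetherian

variable {T : Type*} [LinearOrder T]

/-- `t` is the largest element of the support of `f`. -/
def IsLeadingTerm (f : T →₀ ℤ) (t : T) : Prop :=
  f t ≠ 0 ∧ ∀ s, t < s → f s = 0

theorem exists_isLeadingTerm {f : T →₀ ℤ} (hf : f ≠ 0) : ∃ t, IsLeadingTerm f t := by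
  have hne := Finsupp.support_nonempty_iff.2 hf
  refine ⟨f.support.max' hne, Finsupp.mem_support_iff.1 (f.support.max'_mem hne), fun s hs => ?_⟩
  by_contra h
  exact absurd (f.support.le_max' s (Finsupp.mem_support_iff.2 h)) (not_le.2 hs)

theorem IsLeadingTerm.unique {f : T →₀ ℤ} {s t : T} (hs : IsLeadingTerm f s)
    (ht : IsLeadingTerm f t) : s = t := by
  rcases lt_trichotomy s t with h | h | h
  · exact absurd (hs.2 t h) ht.1
  · exact h
  · exact absurd (ht.2 s h) hs.1

theorem IsLeadingTerm.mapDomain {f : T →₀ ℤ} {s : T} (hs : IsLeadingTerm f s) {o : T → T}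
    (ho : StrictMono o) : IsLeadingTerm (f.mapDomain o) (o s) := by
  refine ⟨by rw [Finsupp.mapDomain_apply ho.injective]; exact hs.1, fun u hu => ?_⟩
  by_cases h : u ∈ Set.range o
  · obtain ⟨v, rfl⟩ := h
    rw [Finsupp.mapDomain_apply ho.injective]
    exact hs.2 v (ho.lt_iff_lt.1 hu)
  · exact Finsupp.mapDomain_of_notMem_range _ _ h

/-- A finite subset of `N` whose leading terms divide all leading terms of `N`. -/
theorem exists_finset_leadingTerm (Ω : Set (T → T))
    (hwqo : ∀ t : ℕ → T, ∃ g : ℕ ↪o ℕ, ∀ m n, m < n → ∃ o ∈ Ω, o (t (g m)) = t (g n))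
    (N : AddSubgroup (T →₀ ℤ)) :
    ∃ B : Finset (T →₀ ℤ), (∀ b ∈ B, b ∈ N) ∧ ∀ f ∈ N, ∀ t, IsLeadingTerm f t →
      ∃ b ∈ B, ∃ s, IsLeadingTerm b s ∧ (b s).natAbs ≤ (f t).natAbs ∧ ∃ o ∈ Ω, o s = t := by
  by_contra! hcon
  obtain ⟨F, hF, hF'⟩ := exists_seq_of_forall_finset_exists
    (fun f : T →₀ ℤ => f ∈ N ∧ ∃ t, IsLeadingTerm f t)
    (fun x y => ∀ s t, IsLeadingTerm x s → IsLeadingTerm y t → (x s).natAbs ≤ (y t).natAbs →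
      ∀ o ∈ Ω, o s ≠ t)
    (fun S hS => by
      obtain ⟨f, hf, t, ht, h⟩ := hcon S fun b hb => (hS b hb).1
      refine ⟨f, ⟨hf, t, ht⟩, fun b hb s t' hs ht' => ?_⟩
      obtain rfl := ht.unique ht'
      exact h b hb s hs)
  choose hFN t ht using hF
  obtain ⟨g, hg⟩ := hwqo t
  obtain ⟨m, n, hmn, hle⟩ := wellQuasiOrdered_le fun k => (F (g k) (t (g k))).natAbs
  obtain ⟨o, ho, hot⟩ := hg m n hmn
  exact hF' _ _ (g.strictMono hmn) _ _ (ht _) (ht _) hle o ho hot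

/-- An equivariant Hilbert basis theorem: if the strictly monotone maps `Ω` make `T` well
quasi-ordered, then every `Ω`-stable subgroup of `T →₀ ℤ` is finitely generated up to `Ω`. -/
theorem exists_finset_generators_of_strictMono [WellFoundedLT T] (Ω : Set (T → T))
    (hmono : ∀ o ∈ Ω, StrictMono o)
    (hwqo : ∀ t : ℕ → T, ∃ g : ℕ ↪o ℕ, ∀ m n, m < n → ∃ o ∈ Ω, o (t (g m)) = t (g n))
    (N : AddSubgroup (T →₀ ℤ)) (hN : ∀ o ∈ Ω, ∀ v ∈ N, v.mapDomain o ∈ N) :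
    ∃ B : Finset (T →₀ ℤ), (∀ b ∈ B, b ∈ N) ∧ ∀ K : AddSubgroup (T →₀ ℤ),
      (∀ o ∈ Ω, ∀ v ∈ K, v.mapDomain o ∈ K) → (∀ b ∈ B, b ∈ K) → N ≤ K := by
  obtain ⟨B, hBN, hB⟩ := exists_finset_leadingTerm Ω hwqo N
  refine ⟨B, hBN, fun K hK hBK => ?_⟩
  suffices h : ∀ t, ∀ n : ℕ, ∀ f ∈ N, (∀ s, t < s → f s = 0) → (f t).natAbs = n → f ∈ K by
    intro f hf
    by_cases hf0 : f = 0
    · exact hf0 ▸ K.zero_mem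
    · obtain ⟨t, ht⟩ := exists_isLeadingTerm hf0
      exact h t _ f hf ht.2 rfl
  intro t
  induction t using WellFoundedLT.induction with
  | ind t iht =>
  intro n
  induction n using Nat.strong_induction_on with
  | h n ihn =>
  rintro f hf hft rfl
  by_cases h0 : f t = 0
  · by_cases hf0 : f = 0
    · exact hf0 ▸ K.zero_mem
    · obtain ⟨s, hs⟩ := exists_isLeadingTerm hf0
      refine iht s ?_ _ f hf hs.2 rfl
      rcases lt_trichotomy s t with h | h | h
      · exact h
      · exact absurd (h ▸ h0) hs.1
      · exact absurd (hft s h) hs.1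
  · obtain ⟨b, hb, s, hs, hle, o, ho, rfl⟩ := hB f hf t ⟨h0, hft⟩
    have hl := hs.mapDomain (hmono o ho)
    have hv : b.mapDomain o (o s) = b s := Finsupp.mapDomain_apply (hmono o ho).injective _ _
    have hgN := hN o ho b (hBN b hb)
    have hgK := hK o ho b (hBK b hb)
    generalize b.mapDomain o = g at *
    obtain ⟨ε, hε⟩ := Int.exists_natAbs_sub_mul_lt hs.1 hle
    have key : (f - ε • g) (o s) = f (o s) - ε * b s := by simp [hv]
    have := ihn _ (by rwa [key]) (f - ε • g) (N.sub_mem hf (N.zsmul_mem hgN ε))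
      (fun u hu => by simp [hft u hu, hl.2 u hu]) rfl
    simpa using K.add_mem this (K.zsmul_mem hgK ε)

/-- The equivariant Hilbert basis theorem for a commutative group generated by the image of `T`. -/
theorem exists_finset_generators_of_closure_range [WellFoundedLT T] (Ω : Set (T → T))
    (hmono : ∀ o ∈ Ω, StrictMono o)
    (hwqo : ∀ t : ℕ → T, ∃ g : ℕ ↪o ℕ, ∀ m n, m < n → ∃ o ∈ Ω, o (t (g m)) = t (g n))
    {A : Type*} [CommGroup A] (p : T → A) (hp : Subgroup.closure (Set.range p) = ⊤)
    (P : Subgroup A → Prop)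
    (hP : ∀ K, P K → ∀ o ∈ Ω, ∀ F : Finset T,
      ∃ ψ : A →* A, (∀ a ∈ K, ψ a ∈ K) ∧ ∀ t ∈ F, p (o t) = ψ (p t))
    (N : Subgroup A) (hN : P N) :
    ∃ B : Finset A, (∀ b ∈ B, b ∈ N) ∧ ∀ K, P K → (∀ b ∈ B, b ∈ K) → N ≤ K := by
  classical
  let π : (T →₀ ℤ) →+ Additive A :=
    Finsupp.liftAddHom fun t => zmultiplesHom (Additive A) (Additive.ofMul (p t))
  have hπ : ∀ v, π v = v.sum fun t n => n • Additive.ofMul (p t) := fun v => rfl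
  let L : Subgroup A → AddSubgroup (T →₀ ℤ) := fun K => (Subgroup.toAddSubgroup K).comap π
  have hL : ∀ K v, v ∈ L K ↔ (π v).toMul ∈ K := fun K v => Iff.rfl
  have hLΩ : ∀ K, P K → ∀ o ∈ Ω, ∀ v ∈ L K, v.mapDomain o ∈ L K := by
    intro K hK o ho v hv
    obtain ⟨ψ, hψK, hψ⟩ := hP K hK o ho v.support
    have : π (v.mapDomain o) = MonoidHom.toAdditive ψ (π v) := by
      rw [hπ, hπ, Finsupp.sum_mapDomain_index (by simp) (by intros; rw [add_smul]),
        map_finsuppSum]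
      refine Finsupp.sum_congr fun t ht => ?_
      rw [hψ t ht, map_zsmul]
      rfl
    rw [hL, this]
    exact hψK _ hv
  have hsurj : ∀ a : A, ∃ v, (π v).toMul = a := by
    intro a
    have ha : a ∈ Subgroup.closure (Set.range p) := hp ▸ Subgroup.mem_top a
    induction ha using Subgroup.closure_induction with
    | mem x hx =>
      obtain ⟨t, rfl⟩ := hx
      exact ⟨Finsupp.single t 1, by simp [hπ]⟩
    | one => exact ⟨0, by simp⟩
    | mul x y _ _ hx hy =>
      obtain ⟨v, rfl⟩ := hx
      obtain ⟨w, rfl⟩ := hy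
      exact ⟨v + w, by simp⟩
    | inv x _ hx =>
      obtain ⟨v, rfl⟩ := hx
      exact ⟨-v, by simp⟩
  obtain ⟨B, hBN, hB⟩ := exists_finset_generators_of_strictMono Ω hmono hwqo (L N) (hLΩ N hN)
  refine ⟨B.image fun v => (π v).toMul, ?_, fun K hK hBK a ha => ?_⟩
  · simpa [hL] using hBN
  · obtain ⟨v, rfl⟩ := hsurj a
    exact hB (L K) (hLΩ K hK) (fun b hb => hBK _ (Finset.mem_image_of_mem _ hb)) ha

end Noetherian

/-- Higman's lemma for finite initial segments of functions on `ℕ`. -/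
theorem exists_orderEmbedding_subseq_of_wellQuasiOrdered {α : Type*} (r : α → α → Prop)
    [IsPreorder α r] (hr : WellQuasiOrdered r) (w : ℕ → ℕ → α) (len : ℕ → ℕ) :
    ∃ g : ℕ ↪o ℕ, ∀ m n, m ≤ n → ∃ φ : ℕ ↪o ℕ, ∀ k < len (g m),
      φ k < len (g n) ∧ r (w (g m) k) (w (g n) (φ k)) := by
  have : IsPreorder (List α) (List.SublistForall₂ r) := {}
  obtain ⟨g, hg⟩ := (Set.PartiallyWellOrderedOn.partiallyWellOrderedOn_sublistForall₂ r
    (Set.partiallyWellOrderedOn_of_wellQuasiOrdered hr Set.univ)).exists_monotone_subseq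
    (f := fun n => (List.range (len n)).map (w n)) (by simp)
  refine ⟨g, fun m n hmn => ?_⟩
  obtain ⟨l, hl, hsub⟩ := List.sublistForall₂_iff.1 (hg m n hmn)
  obtain ⟨φ, hφ⟩ := List.sublist_iff_exists_orderEmbedding_getElem?_eq.1 hsub
  refine ⟨φ, fun k hk => ?_⟩
  rw [List.forall₂_iff_get] at hl
  obtain ⟨hlen, hl⟩ := hl
  simp only [List.length_map, List.length_range, List.get_eq_getElem, List.getElem_map,
    List.getElem_range] at hlen hl
  have h1 := hl k hk (hlen ▸ hk)
  have h2 := hφ k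
  rw [List.getElem?_eq_getElem (hlen ▸ hk), eq_comm, List.getElem?_eq_some_iff] at h2
  obtain ⟨h3, h4⟩ := h2
  simp only [List.length_map, List.length_range, List.getElem_map,
    List.getElem_range] at h3 h4
  exact ⟨h3, h4 ▸ h1⟩

theorem strictMono_toLex_prodMap {α β : Type*} [PartialOrder α] [Preorder β] {f : α → α}
    {g : β → β} (hf : StrictMono f) (hg : StrictMono g) :
    StrictMono fun t : α ×ₗ β => toLex (f (ofLex t).1, g (ofLex t).2) := by
  intro s t hst
  rw [Prod.Lex.lt_iff] at hst ⊢
  rcases hst with h | ⟨h, h'⟩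
  · exact Or.inl (hf h)
  · exact Or.inr ⟨congrArg f h, hg h'⟩

theorem strictMono_toColex_mapDomain_add (φ : ℕ ↪o ℕ) (c : ℕ →₀ ℕ) :
    StrictMono fun a : Colex (ℕ →₀ ℕ) => toColex ((ofColex a).mapDomain φ + c) := by
  intro a b hab
  rw [Finsupp.Colex.lt_iff] at hab ⊢
  obtain ⟨i, hi, hlt⟩ := hab
  refine ⟨φ i, fun j hj => ?_, ?_⟩
  · change Finsupp.mapDomain φ (ofColex a) j + c j = Finsupp.mapDomain φ (ofColex b) j + c j
    congr 1
    by_cases h : j ∈ Set.range φ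
    · obtain ⟨k, rfl⟩ := h
      rw [Finsupp.mapDomain_apply φ.injective, Finsupp.mapDomain_apply φ.injective]
      exact hi k (φ.lt_iff_lt.1 hj)
    · rw [Finsupp.mapDomain_of_notMem_range _ _ h, Finsupp.mapDomain_of_notMem_range _ _ h]
  · change Finsupp.mapDomain φ (ofColex a) (φ i) + c (φ i) <
      Finsupp.mapDomain φ (ofColex b) (φ i) + c (φ i)
    rw [Finsupp.mapDomain_apply φ.injective, Finsupp.mapDomain_apply φ.injective]
    exact Nat.add_lt_add_right hlt _

section CommutatorTerm

/-- Formal terms `(a, b, i, j)`, standing for the commutator `⁅x i, x j⁆` conjugated by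
`x ^ (a - b)`. -/
abbrev CommutatorTerm : Type :=
  Colex (ℕ →₀ ℕ) ×ₗ Colex (ℕ →₀ ℕ) ×ₗ ℕ ×ₗ ℕ

/-- The term `(a, b, i, j)`. -/
def CommutatorTerm.mk (a b : ℕ →₀ ℕ) (i j : ℕ) : CommutatorTerm :=
  toLex (toColex a, toLex (toColex b, toLex (i, j)))

theorem CommutatorTerm.exists_mk (t : CommutatorTerm) : ∃ a b i j, t = mk a b i j :=
  ⟨_, _, _, _, rfl⟩

/-- Renaming of the indices along `φ`, followed by multiplication with `x ^ (c - d)`. -/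
noncomputable def CommutatorTerm.shift (φ : ℕ ↪o ℕ) (c d : ℕ →₀ ℕ) (t : CommutatorTerm) :
    CommutatorTerm :=
  toLex (toColex ((ofColex (ofLex t).1).mapDomain φ + c),
    toLex (toColex ((ofColex (ofLex (ofLex t).2).1).mapDomain φ + d),
      toLex (φ (ofLex (ofLex (ofLex t).2).2).1, φ (ofLex (ofLex (ofLex t).2).2).2)))

theorem CommutatorTerm.shift_mk (φ : ℕ ↪o ℕ) (c d a b : ℕ →₀ ℕ) (i j : ℕ) :
    shift φ c d (mk a b i j) = mk (a.mapDomain φ + c) (b.mapDomain φ + d) (φ i) (φ j) :=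
  rfl

theorem CommutatorTerm.shift_strictMono (φ : ℕ ↪o ℕ) (c d : ℕ →₀ ℕ) :
    StrictMono (shift φ c d) :=
  strictMono_toLex_prodMap (strictMono_toColex_mapDomain_add φ c)
    (strictMono_toLex_prodMap (strictMono_toColex_mapDomain_add φ d)
      (strictMono_toLex_prodMap φ.strictMono φ.strictMono))

theorem exists_mapDomain_add_eq {a a' : ℕ →₀ ℕ} {φ : ℕ ↪o ℕ} (h : ∀ k, a k ≤ a' (φ k)) :
    ∃ c, a.mapDomain φ + c = a' := by
  refine ⟨a' - a.mapDomain φ, add_tsub_cancel_of_le fun k => ?_⟩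
  by_cases hk : k ∈ Set.range φ
  · obtain ⟨k, rfl⟩ := hk
    rw [Finsupp.mapDomain_apply φ.injective]
    exact h k
  · rw [Finsupp.mapDomain_of_notMem_range _ _ hk]
    exact Nat.zero_le _

theorem CommutatorTerm.exists_shift_subseq (t : ℕ → CommutatorTerm) :
    ∃ g : ℕ ↪o ℕ, ∀ m n, m < n →
      ∃ o ∈ {o | ∃ φ c d, o = shift φ c d}, o (t (g m)) = t (g n) := by
  choose a b i j ht using fun n => (t n).exists_mk
  have hlen : ∀ n, ∃ l, i n < l ∧ j n < l ∧ ∀ k, l ≤ k → a n k = 0 ∧ b n k = 0 := by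
    intro n
    obtain ⟨l, hl⟩ := ((a n).support ∪ (b n).support ∪ {i n, j n}).bddAbove
    have hl' : ∀ k, l + 1 ≤ k → k ∉ (a n).support ∪ (b n).support ∪ {i n, j n} :=
      fun k hk hk' => absurd (hl hk') (by omega)
    refine ⟨l + 1, ?_, ?_, fun k hk => ?_⟩
    · exact Nat.lt_succ_of_le (hl (by simp))
    · exact Nat.lt_succ_of_le (hl (by simp))
    · have := hl' k hk
      simp only [Finset.mem_union, Finsupp.mem_support_iff] at this
      tauto
  choose len hi hj hzero using hlen
  let r : ℕ × ℕ × Bool × Bool → ℕ × ℕ × Bool × Bool → Prop :=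
    fun p q => p.1 ≤ q.1 ∧ p.2.1 ≤ q.2.1 ∧ p.2.2 = q.2.2
  have : IsPreorder _ r :=
    { refl := fun p => ⟨le_rfl, le_rfl, rfl⟩
      trans := fun p q s h h' =>
        ⟨h.1.trans h'.1, h.2.1.trans h'.2.1, h.2.2.trans h'.2.2⟩ }
  have hr : WellQuasiOrdered r :=
    wellQuasiOrdered_le.prod (wellQuasiOrdered_le.prod (Finite.wellQuasiOrdered (· = ·)))
  obtain ⟨g, hg⟩ := exists_orderEmbedding_subseq_of_wellQuasiOrdered r hr
    (fun n k => (a n k, b n k, decide (k = i n), decide (k = j n))) len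
  refine ⟨g, fun m n hmn => ?_⟩
  obtain ⟨φ, hφ⟩ := hg m n hmn.le
  have hφi : φ (i (g m)) = i (g n) := by
    simpa using (Prod.ext_iff.1 (hφ _ (hi _)).2.2.2).1
  have hφj : φ (j (g m)) = j (g n) := by
    simpa using (Prod.ext_iff.1 (hφ _ (hj _)).2.2.2).2
  have hle : ∀ k, a (g m) k ≤ a (g n) (φ k) ∧ b (g m) k ≤ b (g n) (φ k) := by
    intro k
    rcases lt_or_ge k (len (g m)) with hk | hk
    · exact ⟨(hφ k hk).2.1, (hφ k hk).2.2.1⟩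
    · simp [hzero _ k hk]
  obtain ⟨c, hc⟩ := exists_mapDomain_add_eq fun k => (hle k).1
  obtain ⟨d, hd⟩ := exists_mapDomain_add_eq fun k => (hle k).2
  exact ⟨_, ⟨φ, c, d, rfl⟩, by rw [ht, ht, shift_mk, hc, hd, hφi, hφj]⟩

end CommutatorTerm

theorem Nat.exists_orderEmbedding_subseq (t : ℕ → ℕ) :
    ∃ g : ℕ ↪o ℕ, ∀ m n, m < n →
      ∃ o ∈ {o : ℕ → ℕ | ∃ φ : ℕ ↪o ℕ, o = φ}, o (t (g m)) = t (g n) := by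
  obtain ⟨g, hg⟩ := (wellQuasiOrdered_le (α := ℕ)).exists_monotone_subseq t
  refine ⟨g, fun m n hmn => ⟨_, ⟨OrderEmbedding.ofStrictMono (fun k => k + (t (g n) - t (g m)))
    (fun _ _ h => Nat.add_lt_add_right h _), rfl⟩, ?_⟩⟩
  exact Nat.add_sub_cancel' (hg m n hmn.le)

theorem OrderEmbedding.exists_perm_eqOn (φ : ℕ ↪o ℕ) (S : Finset ℕ) :
    ∃ σ : Equiv.Perm ℕ, ∀ k ∈ S, σ k = φ k := by
  obtain ⟨σ, hσ⟩ := Equiv.Perm.exists_extending_pair (fun k : S => (k : ℕ))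
    (fun k : S => φ k) Subtype.val_injective (φ.injective.comp Subtype.val_injective)
  exact ⟨σ, fun k hk => hσ ⟨k, hk⟩⟩

section Group

open scoped commutatorElement

variable {G : Type*} [Group G] (x : ℕ → G)

/-- The monomial `∏ x k ^ a k` in the abelianization. -/
noncomputable def abelianMonomial (a : ℕ →₀ ℕ) : Abelianization G :=
  a.prod fun k n => Abelianization.of (x k) ^ n

theorem abelianMonomial_add (a b : ℕ →₀ ℕ) :
    abelianMonomial x (a + b) = abelianMonomial x a * abelianMonomial x b :=
  Finsupp.prod_add_index' (by simp) (by intros; rw [pow_add])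

theorem abelianMonomial_mapDomain {θ : G →* G} {φ : ℕ → ℕ} {a : ℕ →₀ ℕ}
    (h : ∀ k ∈ a.support, θ (x k) = x (φ k)) :
    abelianMonomial x (a.mapDomain φ) = Abelianization.map θ (abelianMonomial x a) := by
  rw [abelianMonomial, abelianMonomial,
    Finsupp.prod_mapDomain_index (by simp) (by intros; rw [pow_add]), map_finsuppProd]
  refine Finsupp.prod_congr fun k hk => ?_
  rw [map_pow, Abelianization.map_of, h k hk]

theorem exists_abelianMonomial_div_eq (hx : Subgroup.closure (Set.range x) = ⊤) (g : G) :
    ∃ a b, Abelianization.of g = abelianMonomial x a / abelianMonomial x b := by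
  have hg : g ∈ Subgroup.closure (Set.range x) := hx ▸ Subgroup.mem_top g
  induction hg using Subgroup.closure_induction with
  | mem _ h =>
    obtain ⟨k, rfl⟩ := h
    exact ⟨Finsupp.single k 1, 0, by simp [abelianMonomial]⟩
  | one => exact ⟨0, 0, by simp⟩
  | mul g h _ _ hg hh =>
    obtain ⟨a, b, hab⟩ := hg
    obtain ⟨c, d, hcd⟩ := hh
    exact ⟨a + c, b + d, by
      rw [map_mul, hab, hcd, abelianMonomial_add, abelianMonomial_add, div_mul_div_comm]⟩
  | inv g _ hg =>
    obtain ⟨a, b, hab⟩ := hg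
    exact ⟨b, a, by rw [map_inv, hab, inv_div]⟩

theorem commutator_eq_normalClosure_of_closure_eq_top (hx : Subgroup.closure (Set.range x) = ⊤) :
    commutator G = Subgroup.normalClosure {y | ∃ i j, y = ⁅x i, x j⁆} := by
  set R := Subgroup.normalClosure {y | ∃ i j, y = ⁅x i, x j⁆}
  refine le_antisymm ?_ (Subgroup.normalClosure_le_normal ?_)
  · have hcomm : ∀ i j, Commute (x i : G ⧸ R) (x j : G ⧸ R) := by
      intro i j
      rw [← commutatorElement_eq_one_iff_commute]
      exact (QuotientGroup.eq_one_iff _).2 (Subgroup.subset_normalClosure ⟨i, j, rfl⟩)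
    have h1 : ∀ i (g : G), Commute (x i : G ⧸ R) (g : G ⧸ R) := by
      intro i g
      have hg : g ∈ Subgroup.closure (Set.range x) := hx ▸ Subgroup.mem_top g
      induction hg using Subgroup.closure_induction with
      | mem _ h => obtain ⟨k, rfl⟩ := h; exact hcomm i k
      | one => exact Commute.one_right _
      | mul _ _ _ _ h h' => exact h.mul_right h'
      | inv _ _ h => exact h.inv_right
    have h2 : ∀ g h : G, Commute (g : G ⧸ R) (h : G ⧸ R) := by
      intro g h
      have hg : g ∈ Subgroup.closure (Set.range x) := hx ▸ Subgroup.mem_top g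
      induction hg using Subgroup.closure_induction with
      | mem _ h => obtain ⟨k, rfl⟩ := h; exact h1 k _
      | one => exact Commute.one_left _
      | mul _ _ _ _ h h' => exact h.mul_left h'
      | inv _ _ h => exact h.inv_left
    rw [commutator_def, Subgroup.commutator_le]
    intro g _ h _
    rw [← QuotientGroup.eq_one_iff]
    exact commutatorElement_eq_one_iff_commute.2 (h2 g h)
  · rintro _ ⟨i, j, rfl⟩
    exact Subgroup.commutator_mem_commutator (Subgroup.mem_top _) (Subgroup.mem_top _)

/-- The element `g * ⁅x i, x j⁆ * g⁻¹` of the commutator subgroup. -/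
def conjCommutator (g : G) (i j : ℕ) : commutator G :=
  ⟨g * ⁅x i, x j⁆ * g⁻¹, (inferInstance : (commutator G).Normal).conj_mem _
    (Subgroup.commutator_mem_commutator (Subgroup.mem_top _) (Subgroup.mem_top _)) g⟩

theorem conjCommutator_congr [IsMulCommutative (commutator G)] {g h : G}
    (hgh : Abelianization.of g = Abelianization.of h) (i j : ℕ) :
    conjCommutator x g i j = conjCommutator x h i j := by
  have hmem : h⁻¹ * g ∈ commutator G := QuotientGroup.eq.1 hgh.symm
  have hc := congrArg Subtype.val (mul_comm' (⟨_, hmem⟩ : commutator G) (conjCommutator x 1 i j))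
  refine Subtype.ext ?_
  simp only [conjCommutator, Subgroup.coe_mul, one_mul, inv_one, mul_one] at hc ⊢
  calc g * ⁅x i, x j⁆ * g⁻¹ = h * (h⁻¹ * g * ⁅x i, x j⁆) * g⁻¹ := by group
    _ = h * ⁅x i, x j⁆ * h⁻¹ := by rw [hc]; group

/-- The element of the commutator subgroup represented by a formal term. -/
noncomputable def CommutatorTerm.eval (t : CommutatorTerm) : commutator G :=
  conjCommutator x (Quotient.out
    (abelianMonomial x (ofColex (ofLex t).1) / abelianMonomial x (ofColex (ofLex (ofLex t).2).1)))
    (ofLex (ofLex (ofLex t).2).2).1 (ofLex (ofLex (ofLex t).2).2).2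

theorem CommutatorTerm.eval_mk [IsMulCommutative (commutator G)] {g : G} {a b : ℕ →₀ ℕ}
    (h : Abelianization.of g = abelianMonomial x a / abelianMonomial x b) (i j : ℕ) :
    eval x (mk a b i j) = conjCommutator x g i j :=
  conjCommutator_congr x ((Quotient.out_eq _).trans h.symm) i j

theorem CommutatorTerm.closure_range_eval [IsMulCommutative (commutator G)]
    (hx : Subgroup.closure (Set.range x) = ⊤) :
    Subgroup.closure (Set.range (eval x)) = ⊤ := by
  have hle : commutator G ≤ (Subgroup.closure (Set.range (eval x))).map (commutator G).subtype := by
    rw [MonoidHom.map_closure]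
    conv_lhs => rw [commutator_eq_normalClosure_of_closure_eq_top x hx]
    refine Subgroup.closure_mono fun y hy => ?_
    obtain ⟨_, ⟨i, j, rfl⟩, hy⟩ := Group.mem_conjugatesOfSet_iff.1 hy
    obtain ⟨g, rfl⟩ := isConj_iff.1 hy
    obtain ⟨a, b, hab⟩ := exists_abelianMonomial_div_eq x hx g
    exact ⟨_, ⟨mk a b i j, rfl⟩, congrArg Subtype.val (eval_mk x hab i j)⟩
  refine eq_top_iff.2 fun c _ => ?_
  obtain ⟨d, hd, hdc⟩ := hle c.2
  rwa [← Subtype.ext hdc]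

variable {x} (ρ : Equiv.Perm ℕ → G →* G)

/-- Normal subgroups stable under all the endomorphisms `ρ σ`. -/
structure IsInvariantNormal (K : Subgroup G) : Prop where
  normal : K.Normal
  map_mem : ∀ σ, ∀ k ∈ K, ρ σ k ∈ K

variable {ρ}

theorem CommutatorTerm.exists_hom_eval_shift [IsMulCommutative (commutator G)]
    (hρ : ∀ σ i, ρ σ (x i) = x (σ i)) {K : Subgroup G} (hK : IsInvariantNormal ρ K)
    (φ : ℕ ↪o ℕ) (c d : ℕ →₀ ℕ) (F : Finset CommutatorTerm) :
    ∃ ψ : commutator G →* commutator G,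
      (∀ h ∈ K.subgroupOf (commutator G), ψ h ∈ K.subgroupOf (commutator G)) ∧
      ∀ t ∈ F, eval x (shift φ c d t) = ψ (eval x t) := by
  classical
  choose a b i j ht using CommutatorTerm.exists_mk
  obtain ⟨σ, hσ⟩ := φ.exists_perm_eqOn
    (F.biUnion fun t => (a t).support ∪ (b t).support ∪ {i t, j t})
  obtain ⟨γ, hγ⟩ := QuotientGroup.mk_surjective (abelianMonomial x c / abelianMonomial x d)
  have hmaps : ∀ h ∈ commutator G, γ * ρ σ h * γ⁻¹ ∈ commutator G := by
    intro h hh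
    refine (inferInstance : (commutator G).Normal).conj_mem _ ?_ γ
    rw [← Abelianization.ker_of]
    exact Abelianization.commutator_subset_ker (Abelianization.of.comp (ρ σ)) hh
  refine ⟨(((MulAut.conj γ).toMonoidHom.comp (ρ σ)).comp (commutator G).subtype).codRestrict
    (commutator G) fun h => hmaps h h.2, fun h hh => ?_, fun t htF => ?_⟩
  · exact hK.normal.conj_mem _ (hK.map_mem σ _ hh) γ
  · have hσt : ∀ k ∈ (a t).support ∪ (b t).support ∪ {i t, j t}, ρ σ (x k) = x (φ k) :=
      fun k hk => by rw [hρ, hσ k (Finset.mem_biUnion.2 ⟨t, htF, hk⟩)]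
    obtain ⟨g, hg⟩ := QuotientGroup.mk_surjective
      (abelianMonomial x (a t) / abelianMonomial x (b t))
    have hg' : Abelianization.of (γ * ρ σ g) =
        abelianMonomial x ((a t).mapDomain φ + c) / abelianMonomial x ((b t).mapDomain φ + d) := by
      have h1 : Abelianization.of γ = _ := hγ
      have h2 : Abelianization.of (ρ σ g) = Abelianization.map (ρ σ) (Abelianization.of g) := rfl
      have h3 : Abelianization.of g = _ := hg
      rw [map_mul, h1, h2, h3, map_div, abelianMonomial_add, abelianMonomial_add,
        abelianMonomial_mapDomain x fun k hk => hσt k (by simp [Finsupp.mem_support_iff.1 hk]),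
        abelianMonomial_mapDomain x fun k hk => hσt k (by simp [Finsupp.mem_support_iff.1 hk]),
        div_mul_div_comm, mul_comm (abelianMonomial x c), mul_comm (abelianMonomial x d)]
    rw [ht t, CommutatorTerm.shift_mk, CommutatorTerm.eval_mk x hg', CommutatorTerm.eval_mk x hg]
    refine Subtype.ext ?_
    simp [conjCommutator, map_commutatorElement, hσt, mul_assoc]

theorem exists_finset_generators_inf_commutator [IsMulCommutative (commutator G)]
    (hx : Subgroup.closure (Set.range x) = ⊤) (hρ : ∀ σ i, ρ σ (x i) = x (σ i))
    {N : Subgroup G} (hN : IsInvariantNormal ρ N) :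
    ∃ B : Finset G, (∀ b ∈ B, b ∈ N) ∧ ∀ K, IsInvariantNormal ρ K → (∀ b ∈ B, b ∈ K) →
      N ⊓ commutator G ≤ K := by
  classical
  let _ : CommGroup (commutator G) := { mul_comm := mul_comm' }
  obtain ⟨B, hBN, hB⟩ := exists_finset_generators_of_closure_range
    {o | ∃ φ c d, o = CommutatorTerm.shift φ c d}
    (by rintro _ ⟨φ, c, d, rfl⟩; exact CommutatorTerm.shift_strictMono φ c d)
    CommutatorTerm.exists_shift_subseq (CommutatorTerm.eval x)
    (CommutatorTerm.closure_range_eval x hx)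
    (fun L => ∃ K, IsInvariantNormal ρ K ∧ L = K.subgroupOf (commutator G))
    (by
      rintro _ ⟨K, hK, rfl⟩ _ ⟨φ, c, d, rfl⟩ F
      exact CommutatorTerm.exists_hom_eval_shift hρ hK φ c d F)
    (N.subgroupOf (commutator G)) ⟨N, hN, rfl⟩
  refine ⟨B.image Subtype.val, by simpa [Subgroup.mem_subgroupOf] using hBN,
    fun K hK hBK g hg => ?_⟩
  exact hB _ ⟨K, hK, rfl⟩ (fun b hb => hBK _ (Finset.mem_image_of_mem _ hb))
    (show (⟨g, hg.2⟩ : commutator G) ∈ _ from hg.1)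

theorem exists_finset_generators_sup_commutator
    (hx : Subgroup.closure (Set.range x) = ⊤) (hρ : ∀ σ i, ρ σ (x i) = x (σ i))
    {N : Subgroup G} (hN : IsInvariantNormal ρ N) :
    ∃ B : Finset G, (∀ b ∈ B, b ∈ N) ∧ ∀ K, IsInvariantNormal ρ K → (∀ b ∈ B, b ∈ K) →
      N ≤ K ⊔ commutator G := by
  classical
  obtain ⟨B, hBN, hB⟩ := exists_finset_generators_of_closure_range
    {o : ℕ → ℕ | ∃ φ : ℕ ↪o ℕ, o = φ}
    (by rintro _ ⟨φ, rfl⟩; exact φ.strictMono)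
    Nat.exists_orderEmbedding_subseq (fun k => Abelianization.of (x k))
    (by
      rw [← Function.comp_def, Set.range_comp, ← MonoidHom.map_closure, hx,
        Subgroup.map_top_of_surjective _ QuotientGroup.mk_surjective])
    (fun L => ∃ K, IsInvariantNormal ρ K ∧ L = K.map Abelianization.of)
    (by
      rintro _ ⟨K, hK, rfl⟩ _ ⟨φ, rfl⟩ F
      obtain ⟨σ, hσ⟩ := φ.exists_perm_eqOn F
      refine ⟨Abelianization.map (ρ σ), ?_, fun t ht => ?_⟩
      · rintro _ ⟨k, hk, rfl⟩
        exact ⟨_, hK.map_mem σ k hk, rfl⟩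
      · rw [Abelianization.map_of, hρ, hσ t ht])
    (N.map Abelianization.of) ⟨N, hN, rfl⟩
  obtain ⟨C, hCN, rfl⟩ := Finset.subset_set_image_iff.1
    (show (B : Set (Abelianization G)) ⊆ Abelianization.of '' (N : Set G) from hBN)
  refine ⟨C, hCN, fun K hK hCK => ?_⟩
  have := hB _ ⟨K, hK, rfl⟩ fun b hb => by
    obtain ⟨c, hc, rfl⟩ := Finset.mem_image.1 hb
    exact Subgroup.mem_map_of_mem _ (hCK c hc)
  rw [Subgroup.map_le_iff_le_comap, Subgroup.comap_map_eq, Abelianization.ker_of] at this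
  exact this

theorem exists_finset_generators_of_isInvariantNormal [IsMulCommutative (commutator G)]
    (hx : Subgroup.closure (Set.range x) = ⊤) (hρ : ∀ σ i, ρ σ (x i) = x (σ i))
    {N : Subgroup G} (hN : IsInvariantNormal ρ N) :
    ∃ B : Finset G, (∀ b ∈ B, b ∈ N) ∧ ∀ K, IsInvariantNormal ρ K → K ≤ N → (∀ b ∈ B, b ∈ K) →
      N ≤ K := by
  classical
  obtain ⟨B, hBN, hB⟩ := exists_finset_generators_inf_commutator hx hρ hN
  obtain ⟨C, hCN, hC⟩ := exists_finset_generators_sup_commutator hx hρ hN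
  refine ⟨B ∪ C, fun b hb => (Finset.mem_union.1 hb).elim (hBN b) (hCN b),
    fun K hK hKN hBK n hn => ?_⟩
  have := hK.normal
  obtain ⟨k, hk, c, hc, rfl⟩ := Subgroup.mem_sup_of_normal_left.1
    (hC K hK (fun b hb => hBK b (Finset.mem_union_right _ hb)) hn)
  exact K.mul_mem hk (hB K hK (fun b hb => hBK b (Finset.mem_union_left _ hb))
    ⟨(N.mul_mem_cancel_left (hKN hk)).1 hn, hc⟩)

end Group

theorem permFM_comp (σ τ : Equiv.Perm ℕ) (g : FreeMetabelianGroup) :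
    permFM σ (permFM τ g) = permFM (σ * τ) g := by
  obtain ⟨g, rfl⟩ := QuotientGroup.mk_surjective g
  change QuotientGroup.mk _ = QuotientGroup.mk _
  rw [FreeGroup.map.comp]
  rfl

theorem permFM_one (g : FreeMetabelianGroup) : permFM 1 g = g := by
  obtain ⟨g, rfl⟩ := QuotientGroup.mk_surjective g
  exact congrArg QuotientGroup.mk (FreeGroup.map.id g)

theorem closure_range_mk_of : Subgroup.closure
    (Set.range fun i => (QuotientGroup.mk (FreeGroup.of i) : FreeMetabelianGroup)) = ⊤ := by
  have h := MonoidHom.map_closure (QuotientGroup.mk' (derivedSeries (FreeGroup ℕ) 2))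
    (Set.range FreeGroup.of)
  rw [FreeGroup.closure_range_of, ← Set.range_comp,
    Subgroup.map_top_of_surjective _ QuotientGroup.mk_surjective] at h
  exact h.symm

open scoped commutatorElement in
instance FreeMetabelianGroup.isMulCommutative_commutator :
    IsMulCommutative (commutator FreeMetabelianGroup) := by
  have h := map_derivedSeries_eq (QuotientGroup.mk'_surjective (derivedSeries (FreeGroup ℕ) 2)) 2
  rw [QuotientGroup.map_mk'_self, eq_comm] at h
  have h' : ⁅commutator FreeMetabelianGroup, commutator FreeMetabelianGroup⁆ = ⊥ := by
    exact (congrArg₂ _ (derivedSeries_one _) (derivedSeries_one _)).symm.trans h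
  refine ⟨⟨fun a b => Subtype.ext ?_⟩⟩
  exact commutatorElement_eq_one_iff_mul_comm.1
    ((Subgroup.mem_bot).1 (h' ▸ Subgroup.commutator_mem_commutator a.2 b.2))

/-- Cohen, 1967. Every `Sym(ℕ)`-invariant normal subgroup `N` of the free
metabelian group `M` on free generators `{x_i : i ∈ ℕ}` is finitely generated as a
`Sym(ℕ)`-invariant normal subgroup: there is a finite set `B ⊆ N` such that `N` is the
normal closure in `M` of the orbit `{σ(b) : σ ∈ Sym(ℕ), b ∈ B}`. -/
theorem freeMetabelian_symInvariant_normal_fg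
    (N : Subgroup FreeMetabelianGroup) (hNnormal : N.Normal)
    (hN : ∀ σ : Equiv.Perm ℕ, (permFM σ) '' (N : Set FreeMetabelianGroup) = N) :
    ∃ B : Finset FreeMetabelianGroup, (↑B : Set FreeMetabelianGroup) ⊆ N ∧
      N = Subgroup.normalClosure {y | ∃ σ : Equiv.Perm ℕ, ∃ b ∈ B, y = permFM σ b} := by
  have hinv : IsInvariantNormal permFM N :=
    ⟨hNnormal, fun σ k hk => (hN σ).subset (Set.mem_image_of_mem _ hk)⟩
  obtain ⟨B, hBN, hB⟩ := exists_finset_generators_of_isInvariantNormal closure_range_mk_of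
    (fun σ i => congrArg QuotientGroup.mk (FreeGroup.map.of (f := σ) (x := i))) hinv
  have hle : Subgroup.normalClosure {y | ∃ σ : Equiv.Perm ℕ, ∃ b ∈ B, y = permFM σ b} ≤ N := by
    refine Subgroup.normalClosure_le_normal ?_
    rintro _ ⟨σ, b, hb, rfl⟩
    exact hinv.map_mem σ b (hBN b hb)
  refine ⟨B, hBN, le_antisymm (hB _ ⟨Subgroup.normalClosure_normal, fun σ => ?_⟩ hle
    fun b hb => Subgroup.subset_normalClosure ⟨1, b, hb, (permFM_one b).symm⟩) hle⟩
  have hsurj : Function.Surjective (permFM σ) := fun g =>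
    ⟨permFM σ⁻¹ g, by rw [permFM_comp, mul_inv_cancel, permFM_one]⟩
  refine fun k hk => (Subgroup.map_normalClosure _ _ hsurj).trans_le ?_
    (Subgroup.mem_map_of_mem (permFM σ) hk)
  refine Subgroup.normalClosure_mono ?_
  rintro _ ⟨_, ⟨τ, b, hb, rfl⟩, rfl⟩
  exact ⟨σ * τ, b, hb, permFM_comp σ τ b⟩
end

section
/- Let K be a Noetherian commutative ring and n ≥ 1. Then every Sym(ℕ)-invariant Ψ-closed R̄_n-submodule M of R_n is finitely generated as a Sym(ℕ)-invariant Ψ-closed R̄_n-submodule: there is a finite set B ⊆ M such that M is the smallest R̄_n-submodule of R_n that contains B, satisfies σ(M') ⊆ M' for all σ ∈ Sym(ℕ), and satisfies ψ(M') ⊆ M' for all ψ ∈ Ψ. -/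
open MvPolynomial

/-- The endomorphism `ψ_{kℓ}` of `R_n` with `ψ_{kℓ}(x_{iℓ}) = x_{ik} x_{iℓ}` and
`ψ_{kℓ}(x_{ij}) = x_{ij}` for `j ≠ ℓ`. -/
noncomputable def psiMap (K : Type*) [CommSemiring K] (n : ℕ) (k l : ℕ) :
    MvPolynomial (Fin n × ℕ) K →ₐ[K] MvPolynomial (Fin n × ℕ) K :=
  aeval (fun q : Fin n × ℕ => if q.2 = l then X (q.1, k) * X (q.1, l) else X q)

/-- The Smyth lifting of a relation to sets: every element of `t` lies above some element of `s`. -/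
def SmythRel {α : Type*} (r : α → α → Prop) (s t : Set α) : Prop :=
  ∀ b ∈ t, ∃ a ∈ s, r a b

instance SmythRel.isPreorder {α : Type*} (r : α → α → Prop) [IsPreorder α r] :
    IsPreorder (Set α) (SmythRel r) where
  refl _ b hb := ⟨b, hb, refl_of r b⟩
  trans s t u hst htu c hc := by
    obtain ⟨b, hb, hbc⟩ := htu c hc
    obtain ⟨a, ha, hab⟩ := hst b hb
    exact ⟨a, ha, _root_.trans hab hbc⟩

lemma WellQuasiOrdered.of_smythRel {α : Type*} {r : α → α → Prop}
    (h : WellQuasiOrdered (SmythRel r)) : WellQuasiOrdered r := by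
  intro f
  obtain ⟨i, j, hij, hs⟩ := h fun k => {f k}
  exact ⟨i, j, hij, by simpa [SmythRel] using hs⟩

/-- The Smyth lifting being a well-quasi-order descends along maps reflecting the relations. -/
lemma WellQuasiOrdered.smythRel_of_reflects {α β : Type*} {r : α → α → Prop} {s : β → β → Prop}
    (h : WellQuasiOrdered (SmythRel s)) (g : α → β) (hg : ∀ x y, s (g x) (g y) → r x y) :
    WellQuasiOrdered (SmythRel r) := by
  intro f
  obtain ⟨i, j, hij, hs⟩ := h fun k => g '' f k
  refine ⟨i, j, hij, fun b hb => ?_⟩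
  obtain ⟨_, ⟨a, ha, rfl⟩, hab⟩ := hs (g b) ⟨b, hb, rfl⟩
  exact ⟨a, ha, hg _ _ hab⟩

/-- In a well-quasi-order, every set has a finite subset below all of its elements. -/
lemma WellQuasiOrdered.exists_finset_basis {α : Type*} {r : α → α → Prop}
    (h : WellQuasiOrdered r) (S : Set α) :
    ∃ F : Finset α, (∀ x ∈ F, x ∈ S) ∧ ∀ y ∈ S, ∃ x ∈ F, r x y := by
  by_contra! hcon
  obtain ⟨f, -, hf⟩ := exists_seq_of_forall_finset_exists (· ∈ S) (fun x y => ¬ r x y) hcon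
  obtain ⟨i, j, hij, hr⟩ := h f
  exact hf i j hij hr

lemma WellQuasiOrdered.smythRel_nat_prod {α : Type*} {r : α → α → Prop} [IsPreorder α r]
    (h : WellQuasiOrdered (SmythRel r)) :
    WellQuasiOrdered (SmythRel fun x y : ℕ × α => x.1 ≤ y.1 ∧ r x.2 y.2) := by
  classical
  intro f
  -- slices of the sets, increasing in the first coordinate
  let sl : ℕ → ℕ → Set α := fun k i => {b | ∃ i' ≤ i, (i', b) ∈ f k}
  have hstab : ∀ k, ∃ m, SmythRel r (sl k m) {b | ∃ i, (i, b) ∈ f k} := by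
    intro k
    obtain ⟨F, hF, hb⟩ := h.of_smythRel.exists_finset_basis {b | ∃ i, (i, b) ∈ f k}
    choose! d hd using hF
    refine ⟨F.sup d, fun y hy => ?_⟩
    obtain ⟨x, hx, hxy⟩ := hb y hy
    exact ⟨x, ⟨d x, Finset.le_sup hx, hd x hx⟩, hxy⟩
  choose m hm using hstab
  obtain ⟨g, hg⟩ := h.exists_monotone_subseq fun k => {b | ∃ i, (i, b) ∈ f k}
  have hlist : WellQuasiOrdered (List.SublistForall₂ (SmythRel r)) := by
    have := Set.PartiallyWellOrderedOn.partiallyWellOrderedOn_sublistForall₂ (SmythRel r)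
      (Set.partiallyWellOrderedOn_univ_iff.2 h)
    simpa [Set.partiallyWellOrderedOn_univ_iff] using this
  obtain ⟨i, j, hij, hl⟩ := hlist fun k => (List.range (m (g k))).map (sl (g k))
  refine ⟨g i, g j, g.strictMono hij, ?_⟩
  rw [List.sublistForall₂_iff] at hl
  obtain ⟨l, hl, hsub⟩ := hl
  rintro ⟨e, b⟩ hb
  suffices ∃ a ∈ sl (g i) e, r a b by
    obtain ⟨a, ⟨e', he', ha⟩, hab⟩ := this
    exact ⟨(e', a), ha, he', hab⟩
  by_cases he : e < m (g i)
  · rw [List.sublist_iff_exists_orderEmbedding_getElem?_eq] at hsub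
    obtain ⟨φ, hφ⟩ := hsub
    have hlen := hl.length_eq
    simp only [List.length_map, List.length_range] at hlen
    have h1 := hφ e
    have hel : e < l.length := hlen ▸ he
    rw [List.getElem?_eq_getElem hel] at h1
    have hlt : φ e < m (g j) := by
      by_contra hnot
      rw [List.getElem?_eq_none (by simpa using not_lt.1 hnot)] at h1
      simp at h1
    have h2 : l[e] = sl (g j) (φ e) := by
      rw [List.getElem?_eq_getElem (by simpa using hlt)] at h1
      simpa using h1
    have h3 := List.Forall₂.get hl (i := e) (by simpa using he) hel
    simp only [List.get_eq_getElem, List.getElem_map, List.getElem_range, h2] at h3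
    exact h3 b ⟨e, φ.strictMono.le_apply, hb⟩
  · obtain ⟨a, ha, hab⟩ := hg i j hij.le b ⟨e, hb⟩
    obtain ⟨a', ⟨e', he', ha'⟩, haa'⟩ := hm (g i) a ha
    exact ⟨a', ⟨e', he'.trans (not_lt.1 he), ha'⟩, _root_.trans haa' hab⟩

lemma wellQuasiOrdered_smythRel_prod_fin (Q : Type*) [Finite Q] (k : ℕ) :
    WellQuasiOrdered (SmythRel fun x y : Q × (Fin k → ℕ) => x.1 = y.1 ∧ x.2 ≤ y.2) := by
  induction k with
  | zero =>
    intro f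
    obtain ⟨i, j, hij, h⟩ := Finite.wellQuasiOrdered (α := Set (Q × (Fin 0 → ℕ))) (· = ·) f
    refine ⟨i, j, hij, fun b hb => ⟨b, h ▸ hb, rfl, le_rfl⟩⟩
  | succ k ih =>
    have : IsPreorder (Q × (Fin k → ℕ)) fun x y => x.1 = y.1 ∧ x.2 ≤ y.2 :=
      { refl := fun _ => ⟨rfl, le_rfl⟩
        trans := fun _ _ _ h₁ h₂ => ⟨h₁.1.trans h₂.1, h₁.2.trans h₂.2⟩ }
    refine ih.smythRel_nat_prod.smythRel_of_reflects
      (fun x => (x.2 0, x.1, fun i => x.2 i.succ)) ?_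
    rintro ⟨p, x⟩ ⟨q, y⟩ ⟨h₀, hpq, h⟩
    exact ⟨hpq, fun i => Fin.cases h₀ h i⟩

/-- `CoveredEmb r s w w'`: the list `w` embeds into `w'`, increasing letters with respect to `r`,
in such a way that every letter of `w'` outside of the image lies above an element of `s` or above
a letter of `w` whose image occurs earlier. -/
inductive CoveredEmb {α : Type*} (r : α → α → Prop) : Set α → List α → List α → Prop
  | nil (s : Set α) : CoveredEmb r s [] []
  | hit {s : Set α} {a b : α} {w w' : List α} :
      r a b → CoveredEmb r (insert a s) w w' → CoveredEmb r s (a :: w) (b :: w')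
  | skip {s : Set α} {a b : α} {w w' : List α} :
      a ∈ s → r a b → CoveredEmb r s w w' → CoveredEmb r s w (b :: w')

lemma wellQuasiOrdered_smythRel_coveredEmb {α : Type*} {r : α → α → Prop} [IsPreorder α r]
    (h : WellQuasiOrdered (SmythRel r)) :
    WellQuasiOrdered fun x y : Set α × List α => SmythRel r x.1 y.1 ∧ CoveredEmb r x.1 x.2 y.2 := by
  rw [← Set.partiallyWellOrderedOn_univ_iff,
    Set.PartiallyWellOrderedOn.iff_not_exists_isMinBadSeq (fun x => x.2.length)]
  rintro ⟨f, hf, hmin⟩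
  obtain ⟨g₁, hg₁⟩ := h.exists_monotone_subseq fun k => (f k).1
  obtain ⟨g₂, hg₂⟩ := h.exists_monotone_subseq fun k => {a | (f (g₁ k)).2.head? = some a}
  obtain ⟨g₃, hg₃⟩ := (Finite.wellQuasiOrdered (α := Prop) (· = ·)).exists_monotone_subseq
    fun k => (f (g₁ (g₂ k))).2 = []
  let g : ℕ ↪o ℕ := (g₃.trans g₂).trans g₁
  have hs : ∀ i j, i ≤ j → SmythRel r (f (g i)).1 (f (g j)).1 := fun i j hij =>
    hg₁ _ _ (g₂.monotone (g₃.monotone hij))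
  have hhd : ∀ i j, i ≤ j → SmythRel r {a | (f (g i)).2.head? = some a}
      {a | (f (g j)).2.head? = some a} := fun i j hij => hg₂ _ _ (g₃.monotone hij)
  have hne : ∀ i, (f (g i)).2 ≠ [] := by
    intro i hi
    have hj : (f (g (i + 1))).2 = [] := by
      have := hg₃ i (i + 1) i.le_succ
      exact this.mp hi
    refine hf.2 (g i) (g (i + 1)) (g.strictMono i.lt_succ_self) ⟨hs _ _ i.le_succ, ?_⟩
    rw [hi, hj]
    exact .nil _
  choose a u hau using fun i => List.exists_cons_of_ne_nil (hne i)
  have haa : ∀ i j, i ≤ j → r (a i) (a j) := by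
    intro i j hij
    simpa [SmythRel, hau] using hhd i j hij
  have hbad := hmin (g 0)
    (fun k => if k < g 0 then f k else (insert (a (k - g 0)) (f (g (k - g 0))).1, u (k - g 0)))
    (fun k hk => (if_pos hk).symm) (by simp [hau])
  have key : ∀ (k : ℕ) (x : Set α × List α), SmythRel r x.1 (insert (a k) (f (g k)).1) →
      CoveredEmb r x.1 x.2 (u k) →
        SmythRel r x.1 (f (g k)).1 ∧ CoveredEmb r x.1 x.2 (f (g k)).2 := by
    intro k x h₁ h₂
    refine ⟨fun b hb => h₁ b (Set.mem_insert_of_mem _ hb), ?_⟩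
    obtain ⟨c, hc, hca⟩ := h₁ (a k) (Set.mem_insert _ _)
    rw [hau]
    exact .skip hc hca h₂
  apply hbad
  refine ⟨fun _ => Set.mem_univ _, fun i j hij hr => ?_⟩
  by_cases hj : j < g 0
  · simp only [hj, hij.trans hj, if_true] at hr
    exact hf.2 i j hij hr
  · obtain ⟨j', rfl⟩ := Nat.exists_eq_add_of_le (not_lt.1 hj)
    by_cases hi : i < g 0
    · simp only [hi, if_true, hj, if_false, Nat.add_sub_cancel_left] at hr
      exact hf.2 i (g j') (hi.trans_le (g.monotone j'.zero_le)) (key _ _ hr.1 hr.2)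
    · obtain ⟨i', rfl⟩ := Nat.exists_eq_add_of_le (not_lt.1 hi)
      simp only [hi, hj, if_false, Nat.add_sub_cancel_left] at hr
      have hij' : i' < j' := by omega
      refine hf.2 (g i') (g j') (g.strictMono hij') ⟨hs _ _ hij'.le, ?_⟩
      rw [hau, hau]
      exact .hit (haa _ _ hij'.le) hr.2

/-- A variant of Higman's lemma for embeddings of lists in which the omitted letters have to be
dominated by earlier letters. -/
lemma wellQuasiOrdered_coveredEmb {α : Type*} {r : α → α → Prop} [IsPreorder α r]
    (h : WellQuasiOrdered (SmythRel r)) : WellQuasiOrdered (CoveredEmb r ∅) := by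
  intro f
  obtain ⟨i, j, hij, -, hc⟩ := wellQuasiOrdered_smythRel_coveredEmb h fun k => (∅, f k)
  exact ⟨i, j, hij, hc⟩

/-- If the binary number with bits `A'` is at most the one with bits `A`, then any `k` bits of `A'`
give at most the number with the `k` top bits of `A`. -/
lemma sum_two_pow_le_of_top {A A' S T : Finset ℕ} (hT : T ⊆ A') (hcard : T.card = S.card)
    (htop : ∀ a ∈ A, a ∉ S → ∀ b ∈ S, a < b) (hle : ∑ a ∈ A', 2 ^ a ≤ ∑ a ∈ A, 2 ^ a) :
    ∑ a ∈ T, 2 ^ a ≤ ∑ a ∈ S, 2 ^ a := by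
  by_contra! hlt
  rw [Finset.geomSum_lt_geomSum_iff_toColex_lt_toColex le_rfl,
    Finset.Colex.toColex_lt_toColex_iff_exists_forall_lt] at hlt
  obtain ⟨x, hxT, hxS, hx⟩ := hlt
  obtain ⟨z, hzS, hzT⟩ : ∃ z ∈ S, z ∉ T := by
    by_contra! hST
    exact hxS (Finset.eq_of_subset_of_card_le hST hcard.le ▸ hxT)
  have hzx := hx z hzS hzT
  refine hle.not_gt ?_
  rw [Finset.geomSum_lt_geomSum_iff_toColex_lt_toColex le_rfl,
    Finset.Colex.toColex_lt_toColex_iff_exists_forall_lt]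
  refine ⟨x, hT hxT, fun hxA => (htop x hxA hxS z hzS).asymm hzx, fun b hbA hbA' => ?_⟩
  by_cases hb : b ∈ S
  · exact hx b hb fun h => hbA' (hT h)
  · exact (htop b hbA hb z hzS).trans hzx

/-- A code of the `i`-th entry of a column; it compares entries, breaking ties by the index. -/
def entryCode {n : ℕ} (γ : Fin n → ℕ) (i : Fin n) : ℕ := n * γ i + i

lemma entryCode_pair_injective {n : ℕ} {γ δ : Fin n → ℕ} {i j : Fin n}
    (h : entryCode γ i = entryCode δ j) : i = j ∧ γ i = δ j := by
  have hn : 0 < n := i.pos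
  have h₁ := congrArg (· % n) h
  have h₂ := congrArg (· / n) h
  simp only [entryCode, Nat.mul_add_mod, Nat.mod_eq_of_lt i.2, Nat.mod_eq_of_lt j.2] at h₁
  simp only [entryCode, Nat.mul_add_div hn, Nat.div_eq_of_lt i.2, Nat.div_eq_of_lt j.2,
    add_zero] at h₂
  exact ⟨Fin.ext h₁, h₂⟩

lemma entryCode_injective {n : ℕ} (γ : Fin n → ℕ) : Function.Injective (entryCode γ) :=
  fun _ _ h => (entryCode_pair_injective h).1

lemma le_of_entryCode_lt {n : ℕ} {γ : Fin n → ℕ} {i j : Fin n}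
    (h : entryCode γ i < entryCode γ j) : γ i ≤ γ j := by
  by_contra! hlt
  have h₁ : n * (γ j + 1) ≤ n * γ i := Nat.mul_le_mul_left n hlt
  have := j.2
  simp only [entryCode] at h
  rw [mul_add] at h₁
  omega

/-- The numerical value by which columns of exponents are compared. -/
def colVal {n : ℕ} (γ : Fin n → ℕ) : ℕ := ∑ i, 2 ^ entryCode γ i

lemma sum_image_entryCode {n : ℕ} (γ : Fin n → ℕ) (S : Finset (Fin n)) :
    ∑ a ∈ S.image (entryCode γ), 2 ^ a = ∑ i ∈ S, 2 ^ entryCode γ i :=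
  Finset.sum_image fun _ _ _ _ h => entryCode_injective γ h

lemma colVal_injective (n : ℕ) : Function.Injective (colVal (n := n)) := by
  intro γ δ h
  rw [colVal, colVal, ← sum_image_entryCode, ← sum_image_entryCode] at h
  have h' := Finset.geomSum_injective le_rfl h
  ext i
  have hi : entryCode γ i ∈ Finset.univ.image (entryCode δ) := h' ▸ by simp
  obtain ⟨j, -, hj⟩ := Finset.mem_image.1 hi
  obtain ⟨rfl, hji⟩ := entryCode_pair_injective hj
  exact hji.symm

lemma colVal_zero_le {n : ℕ} (γ : Fin n → ℕ) : colVal (0 : Fin n → ℕ) ≤ colVal γ :=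
  Finset.sum_le_sum fun i _ => Nat.pow_le_pow_right two_pos (by simp [entryCode])

/-- The indicator function of a finite set, as a column of exponents. -/
def indCol {n : ℕ} (S : Finset (Fin n)) (i : Fin n) : ℕ := if i ∈ S then 1 else 0

lemma colVal_add_indCol {n : ℕ} (γ : Fin n → ℕ) (S : Finset (Fin n)) :
    colVal (γ + indCol S) = colVal γ + (2 ^ n - 1) * ∑ i ∈ S, 2 ^ entryCode γ i := by
  have h : ∀ i, 2 ^ entryCode (γ + indCol S) i =
      2 ^ entryCode γ i + (2 ^ n - 1) * if i ∈ S then 2 ^ entryCode γ i else 0 := by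
    intro i
    by_cases hi : i ∈ S
    · have : entryCode (γ + indCol S) i = n + entryCode γ i := by
        simp [entryCode, indCol, hi, mul_add]
        ring
      obtain ⟨c, hc⟩ : ∃ c, 2 ^ n = c + 1 := ⟨2 ^ n - 1, by have := Nat.two_pow_pos n; omega⟩
      rw [this, if_pos hi, pow_add, hc, Nat.add_sub_cancel]
      ring
    · simp [entryCode, indCol, hi]
  simp only [colVal, h, Finset.sum_add_distrib, ← Finset.mul_sum]
  simp [Finset.sum_ite_mem]

/-- Adding `1` to the top entries of the bigger column dominates adding `1` to equally many entries
of the smaller column. -/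
lemma colVal_add_indCol_lt {n : ℕ} {γ δ : Fin n → ℕ} {S T : Finset (Fin n)}
    (hcard : T.card = S.card) (htop : ∀ i ∉ S, ∀ j ∈ S, entryCode γ i < entryCode γ j)
    (hle : colVal δ ≤ colVal γ) (hne : T = S → δ ≠ γ) :
    colVal (δ + indCol T) < colVal (γ + indCol S) := by
  have himg : ∀ (ε : Fin n → ℕ) (U : Finset (Fin n)), (U.image (entryCode ε)).card = U.card :=
    fun ε U => Finset.card_image_of_injective _ (entryCode_injective ε)
  have key : ∑ i ∈ T, 2 ^ entryCode δ i ≤ ∑ i ∈ S, 2 ^ entryCode γ i := by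
    rw [← sum_image_entryCode, ← sum_image_entryCode]
    refine sum_two_pow_le_of_top (A := Finset.univ.image (entryCode γ))
      (A' := Finset.univ.image (entryCode δ)) (Finset.image_subset_image (Finset.subset_univ _))
      (by rw [himg, himg, hcard]) ?_ (by rwa [sum_image_entryCode, sum_image_entryCode])
    intro a ha haS b hb
    obtain ⟨i, -, rfl⟩ := Finset.mem_image.1 ha
    obtain ⟨j, hj, rfl⟩ := Finset.mem_image.1 hb
    exact htop i (fun hi => haS (Finset.mem_image_of_mem _ hi)) j hj
  rw [colVal_add_indCol, colVal_add_indCol]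
  by_cases hγ : δ = γ
  · subst hγ
    have hTS : T ≠ S := fun h => hne h rfl
    have hlt : ∑ i ∈ T, 2 ^ entryCode δ i < ∑ i ∈ S, 2 ^ entryCode δ i := by
      refine key.lt_of_ne fun h => hTS ?_
      rw [← sum_image_entryCode, ← sum_image_entryCode] at h
      exact Finset.image_injective (entryCode_injective δ) (Finset.geomSum_injective le_rfl h)
    have hn : 0 < 2 ^ n - 1 := by
      rcases Nat.eq_zero_or_pos n with rfl | hn
      · exact absurd (Subsingleton.elim T S) hTS
      · exact Nat.sub_pos_of_lt (Nat.one_lt_two_pow hn.ne')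
    exact Nat.add_lt_add_left (Nat.mul_lt_mul_of_pos_left hlt hn) _
  · have : colVal δ < colVal γ := hle.lt_of_ne fun h => hγ (colVal_injective n h)
    exact Nat.add_lt_add_of_lt_of_le this (Nat.mul_le_mul_left _ key)

/-- The column of exponents with index `j` of a monomial. -/
def colExp {n : ℕ} (m : Fin n × ℕ →₀ ℕ) (j : ℕ) (i : Fin n) : ℕ := m (i, j)

lemma ext_colExp {n : ℕ} {m m' : Fin n × ℕ →₀ ℕ} (h : ∀ j, colExp m j = colExp m' j) :
    m = m' := by
  ext ⟨i, j⟩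
  exact congrFun (h j) i

@[simp]
lemma colExp_add {n : ℕ} (m m' : Fin n × ℕ →₀ ℕ) (j : ℕ) :
    colExp (m + m') j = colExp m j + colExp m' j := rfl

lemma exists_forall_colExp_eq_zero {n : ℕ} (m : Fin n × ℕ →₀ ℕ) :
    ∃ t, ∀ j ≥ t, colExp m j = 0 := by
  refine ⟨m.support.sup (fun q => q.2 + 1), fun j hj => ?_⟩
  ext i
  by_contra hne
  have : j + 1 ≤ m.support.sup (fun q => q.2 + 1) :=
    Finset.le_sup (f := fun q : Fin n × ℕ => q.2 + 1)
      (Finsupp.mem_support_iff.2 hne : (i, j) ∈ m.support)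
  omega

/-- The colexicographic comparison of monomials, with columns compared by `colVal`. -/
def MonLt {n : ℕ} (m' m : Fin n × ℕ →₀ ℕ) : Prop :=
  ∃ p, (∀ j > p, colExp m' j = colExp m j) ∧ colVal (colExp m' p) < colVal (colExp m p)

lemma MonLt.irrefl {n : ℕ} (m : Fin n × ℕ →₀ ℕ) : ¬ MonLt m m :=
  fun ⟨_, _, h⟩ => h.false

lemma MonLt.trans {n : ℕ} {a b c : Fin n × ℕ →₀ ℕ} (hab : MonLt a b) (hbc : MonLt b c) :
    MonLt a c := by
  obtain ⟨p, hp, hp'⟩ := hab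
  obtain ⟨q, hq, hq'⟩ := hbc
  rcases lt_trichotomy p q with h | rfl | h
  · exact ⟨q, fun j hj => (hp j (h.trans hj)).trans (hq j hj), by rwa [hp q h]⟩
  · exact ⟨p, fun j hj => (hp j hj).trans (hq j hj), hp'.trans hq'⟩
  · exact ⟨p, fun j hj => (hp j hj).trans (hq j (h.trans hj)), by rwa [← hq p h]⟩

lemma MonLt.trichotomy {n : ℕ} {a b : Fin n × ℕ →₀ ℕ} (hab : a ≠ b) : MonLt a b ∨ MonLt b a := by
  obtain ⟨s, hs⟩ := exists_forall_colExp_eq_zero a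
  obtain ⟨t, ht⟩ := exists_forall_colExp_eq_zero b
  have hex : ∃ p, ∀ j ≥ p, colExp a j = colExp b j :=
    ⟨max s t, fun j hj => by
      rw [hs j ((le_max_left _ _).trans hj), ht j ((le_max_right _ _).trans hj)]⟩
  classical
  obtain ⟨p, hp, hmin⟩ : ∃ p, (∀ j ≥ p, colExp a j = colExp b j) ∧
      ∀ q < p, ¬ ∀ j ≥ q, colExp a j = colExp b j :=
    ⟨Nat.find hex, Nat.find_spec hex, fun q hq => Nat.find_min hex hq⟩
  cases p with
  | zero => exact absurd (ext_colExp fun j => hp j j.zero_le) hab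
  | succ p =>
    have hne : colExp a p ≠ colExp b p := by
      intro h
      refine hmin p p.lt_succ_self fun j hj => ?_
      rcases hj.lt_or_eq with hj | rfl
      · exact hp j hj
      · exact h
    rcases lt_or_gt_of_ne fun h => hne (colVal_injective n h) with h | h
    · exact .inl ⟨p, fun j hj => hp j hj, h⟩
    · exact .inr ⟨p, fun j hj => (hp j hj).symm, h⟩

lemma MonLt.wellFounded (n : ℕ) : WellFounded (MonLt (n := n)) := by
  classical
  let key : (Fin n × ℕ →₀ ℕ) → (ℕ →₀ ℕ) := fun m =>
    Finsupp.onFinset (m.support.image Prod.snd)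
      (fun j => colVal (colExp m j) - colVal (0 : Fin n → ℕ))
      (by
        intro j hj
        by_contra hnot
        refine hj ?_
        have : colExp m j = 0 := by
          ext i
          by_contra hi
          exact hnot (Finset.mem_image.2 ⟨(i, j), Finsupp.mem_support_iff.2 hi, rfl⟩)
        simp [this])
  have hwf : WellFounded (Finsupp.Lex (· > ·) (· < ·) : (ℕ →₀ ℕ) → (ℕ →₀ ℕ) → Prop) :=
    Finsupp.Lex.wellFounded' (fun n => n.not_lt_zero) wellFounded_lt
      (wellFounded_lt (α := ℕ))
  refine Subrelation.wf (fun {a b} hab => ?_) (InvImage.wf key hwf)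
  obtain ⟨p, hp, hlt⟩ := hab
  refine ⟨p, fun j hj => ?_, ?_⟩
  · simp [key, hp j hj]
  · have := colVal_zero_le (colExp a p)
    simp only [key, Finsupp.onFinset_apply]
    omega

/-- The monomial supported in column `j` with the given exponents. -/
noncomputable def colEmb {n : ℕ} (j : ℕ) (γ : Fin n → ℕ) : Fin n × ℕ →₀ ℕ :=
  ∑ i, Finsupp.single (i, j) (γ i)

lemma colExp_colEmb {n : ℕ} (j j' : ℕ) (γ : Fin n → ℕ) :
    colExp (colEmb j γ) j' = if j' = j then γ else 0 := by
  classical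
  ext i
  simp only [colExp, colEmb, Finsupp.coe_finsetSum, Finset.sum_apply, Finsupp.single_apply,
    Prod.mk.injEq]
  by_cases h : j' = j
  · simp [h]
  · simp [h, Ne.symm h]

lemma colEmb_add {n : ℕ} (j : ℕ) (γ δ : Fin n → ℕ) :
    colEmb j (γ + δ) = colEmb j γ + colEmb j δ := by
  refine ext_colExp fun j' => ?_
  simp only [colExp_add, colExp_colEmb]
  split_ifs <;> simp

lemma colEmb_zero {n : ℕ} (j : ℕ) : colEmb j (0 : Fin n → ℕ) = 0 := by
  simp [colEmb]

lemma MonLt.colExp_eq_zero {n : ℕ} {m' m : Fin n × ℕ →₀ ℕ} (h : MonLt m' m) {t : ℕ}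
    (ht : ∀ j ≥ t, colExp m j = 0) : ∀ j ≥ t, colExp m' j = 0 := by
  obtain ⟨p, hp, hlt⟩ := h
  have hpt : p < t := by
    by_contra! hpt
    rw [ht p hpt] at hlt
    exact (colVal_zero_le _).not_gt hlt
  exact fun j hj => (hp j (hpt.trans_le hj)).trans (ht j hj)

lemma MonLt.exists_max {n : ℕ} (F : Finset (Fin n × ℕ →₀ ℕ)) (hF : F.Nonempty) :
    ∃ m ∈ F, ∀ m' ∈ F, m' ≠ m → MonLt m' m := by
  classical
  induction hF using Finset.Nonempty.cons_induction with
  | singleton a => exact ⟨a, by simp, by simp⟩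
  | cons a s ha hs ih =>
    obtain ⟨m, hm, hmax⟩ := ih
    rcases MonLt.trichotomy (a := a) (b := m) (by rintro rfl; exact ha hm) with h | h
    · refine ⟨m, by simp [hm], fun m' hm' hne => ?_⟩
      rcases Finset.mem_cons.1 hm' with rfl | hm'
      · exact h
      · exact hmax m' hm' hne
    · refine ⟨a, by simp, fun m' hm' hne => ?_⟩
      rcases Finset.mem_cons.1 hm' with rfl | hm'
      · exact absurd rfl hne
      · rcases eq_or_ne m' m with rfl | hne'
        · exact h
        · exact (hmax m' hm' hne').trans h

section LeadingCoefficients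

variable {K : Type*} [CommRing K] {n : ℕ}

/-- A submodule is column-closed if it is stable under all column permutations and all maps
`psiMap K n k l` with `k ≠ l`. -/
def IsColClosed (N : Submodule (symAlg K n) (MvPolynomial (Fin n × ℕ) K)) : Prop :=
  (∀ σ : Equiv.Perm ℕ, ∀ f ∈ N, colPerm K n σ f ∈ N) ∧
    ∀ k l : ℕ, k ≠ l → ∀ f ∈ N, psiMap K n k l f ∈ N

variable (K) in
/-- The polynomials all of whose monomials are smaller than `m`. -/
noncomputable def lowPoly (m : Fin n × ℕ →₀ ℕ) : Submodule K (MvPolynomial (Fin n × ℕ) K) :=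
  restrictSupport K {m' | MonLt m' m}

lemma monomial_mem_lowPoly {m m' : Fin n × ℕ →₀ ℕ} (h : MonLt m' m) (c : K) :
    monomial m' c ∈ lowPoly K m := by
  classical
  rw [lowPoly, mem_restrictSupport_iff]
  exact (Finset.coe_subset.2 support_monomial_subset).trans (by simpa using h)

lemma lowPoly_le_comap {m m' : Fin n × ℕ →₀ ℕ}
    (g : MvPolynomial (Fin n × ℕ) K →ₗ[K] MvPolynomial (Fin n × ℕ) K)
    (h : ∀ m₁, MonLt m₁ m → ∀ c, g (monomial m₁ c) ∈ lowPoly K m') :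
    lowPoly K m ≤ (lowPoly K m').comap g := by
  intro f hf
  rw [lowPoly, mem_restrictSupport_iff] at hf
  rw [f.as_sum]
  exact Submodule.sum_mem _ fun m₁ hm₁ => h m₁ (hf hm₁) _

/-- The ideal of leading coefficients at `m` of the elements of `N`. -/
def leadIdeal (N : Submodule (symAlg K n) (MvPolynomial (Fin n × ℕ) K))
    (m : Fin n × ℕ →₀ ℕ) : Ideal K where
  carrier := {c | ∃ f ∈ lowPoly K m, monomial m c + f ∈ N}
  zero_mem' := ⟨0, zero_mem _, by simp⟩
  add_mem' := by
    rintro a b ⟨f, hf, hfN⟩ ⟨g, hg, hgN⟩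
    refine ⟨f + g, add_mem hf hg, ?_⟩
    rw [map_add, add_add_add_comm]
    exact add_mem hfN hgN
  smul_mem' := by
    rintro a b ⟨f, hf, hfN⟩
    refine ⟨a • f, Submodule.smul_mem _ _ hf, ?_⟩
    have := N.smul_of_tower_mem a hfN
    rwa [smul_add, smul_monomial] at this

lemma mem_leadIdeal {N : Submodule (symAlg K n) (MvPolynomial (Fin n × ℕ) K)}
    {m : Fin n × ℕ →₀ ℕ} {c : K} :
    c ∈ leadIdeal N m ↔ ∃ f ∈ lowPoly K m, monomial m c + f ∈ N := Iff.rfl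

lemma leadIdeal_le_of_map {N : Submodule (symAlg K n) (MvPolynomial (Fin n × ℕ) K)}
    {m m' : Fin n × ℕ →₀ ℕ}
    (g : MvPolynomial (Fin n × ℕ) K →ₗ[K] MvPolynomial (Fin n × ℕ) K)
    (hgN : ∀ f ∈ N, g f ∈ N)
    (hm : ∀ c, g (monomial m c) - monomial m' c ∈ lowPoly K m')
    (hlow : ∀ m₁, MonLt m₁ m → ∀ c, g (monomial m₁ c) ∈ lowPoly K m') :
    leadIdeal N m ≤ leadIdeal N m' := by
  rintro c ⟨f, hf, hfN⟩
  refine ⟨g (monomial m c) - monomial m' c + g f,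
    add_mem (hm c) (lowPoly_le_comap g hlow hf), ?_⟩
  have := hgN _ hfN
  rw [map_add] at this
  convert this using 1
  abel

variable (K) in
/-- Every column-closed submodule has at `m'` all the leading coefficients it has at `m`. -/
def Reach (m m' : Fin n × ℕ →₀ ℕ) : Prop :=
  ∀ N : Submodule (symAlg K n) (MvPolynomial (Fin n × ℕ) K),
    IsColClosed N → leadIdeal N m ≤ leadIdeal N m'

lemma Reach.refl (m : Fin n × ℕ →₀ ℕ) : Reach K m m := fun _ _ => le_rfl

lemma Reach.trans {a b c : Fin n × ℕ →₀ ℕ} (hab : Reach K a b) (hbc : Reach K b c) :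
    Reach K a c := fun N hN => (hab N hN).trans (hbc N hN)

lemma Reach.of_map {m m' : Fin n × ℕ →₀ ℕ}
    (g : MvPolynomial (Fin n × ℕ) K →ₗ[K] MvPolynomial (Fin n × ℕ) K)
    (θ : (Fin n × ℕ →₀ ℕ) → (Fin n × ℕ →₀ ℕ))
    (hg : ∀ m₁ c, g (monomial m₁ c) = monomial (θ m₁) c)
    (hgN : ∀ N : Submodule (symAlg K n) (MvPolynomial (Fin n × ℕ) K),
      IsColClosed N → ∀ f ∈ N, g f ∈ N)
    (hm : θ m = m') (hlow : ∀ m₁, MonLt m₁ m → MonLt (θ m₁) m') : Reach K m m' := by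
  intro N hN
  refine leadIdeal_le_of_map g (hgN N hN) (fun c => ?_) fun m₁ h c => ?_
  · rw [hg, hm, sub_self]
    exact zero_mem _
  · rw [hg]
    exact monomial_mem_lowPoly (hlow m₁ h) c

lemma colPerm_monomial (σ : Equiv.Perm ℕ) (m : Fin n × ℕ →₀ ℕ) (c : K) :
    colPerm K n σ (monomial m c) =
      monomial (m.equivMapDomain (Equiv.prodCongr (Equiv.refl _) σ)) c := by
  rw [colPerm, rename_monomial, Finsupp.equivMapDomain_eq_mapDomain]
  rfl

lemma psiMap_monomial (k l : ℕ) (m : Fin n × ℕ →₀ ℕ) (c : K) :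
    psiMap K n k l (monomial m c) = monomial (m + colEmb k (colExp m l)) c := by
  classical
  suffices h : psiMap K n k l (monomial m 1) = monomial (m + colEmb k (colExp m l)) 1 by
    rw [← mul_one c, ← smul_eq_mul, ← smul_monomial, map_smul, h, smul_monomial]
  induction m using Finsupp.induction_linear with
  | zero =>
    have : colExp (0 : Fin n × ℕ →₀ ℕ) l = 0 := rfl
    rw [this, colEmb_zero, add_zero, ← C_apply, map_one, map_one]
  | add a b ha hb =>
    rw [colExp_add, colEmb_add, ← one_mul (1 : K), ← monomial_mul, map_mul, ha, hb, monomial_mul,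
      add_add_add_comm]
  | single q e =>
    rw [← X_pow_eq_monomial, map_pow, psiMap, aeval_X]
    obtain ⟨i, j⟩ := q
    by_cases hj : j = l
    · subst hj
      have : colEmb k (colExp (Finsupp.single (i, j) e) j) = Finsupp.single (i, k) e := by
        rw [colEmb, Finset.sum_eq_single i]
        · simp [colExp]
        · intro i' _ hi'
          simp [colExp, Ne.symm hi']
        · simp
      rw [this, if_pos rfl, mul_pow, X_pow_eq_monomial, X_pow_eq_monomial, monomial_mul, one_mul,
        add_comm]
    · have : colExp (Finsupp.single (i, j) e) l = 0 := by
        ext i'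
        simp [colExp, hj]
      rw [this, colEmb_zero, add_zero, if_neg hj, X_pow_eq_monomial]

/-- The permutation of `ℕ` moving `t` to `k` and shifting `k, …, t - 1` up by one. -/
def shiftPerm (k t : ℕ) (h : k ≤ t) : Equiv.Perm ℕ where
  toFun j := if j < k then j else if j < t then j + 1 else if j = t then k else j
  invFun j := if j < k then j else if j = k then t else if j ≤ t then j - 1 else j
  left_inv j := by
    dsimp only
    split_ifs <;> omega
  right_inv j := by
    dsimp only
    split_ifs <;> omega

/-- Repeating the column `l` of `m` at a new column with index `k ≤ l`. -/
lemma Reach.dup {m m' : Fin n × ℕ →₀ ℕ} {k l : ℕ} (hkl : k ≤ l)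
    (hm' : ∀ j, colExp m' j =
      if j < k then colExp m j else if j = k then colExp m l else colExp m (j - 1)) :
    Reach K m m' := by
  obtain ⟨t₀, ht₀⟩ := exists_forall_colExp_eq_zero m
  obtain ⟨t, ht, hlt⟩ : ∃ t, (∀ j ≥ t, colExp m j = 0) ∧ l < t :=
    ⟨max t₀ (l + 1), fun j hj => ht₀ j ((le_max_left _ _).trans hj), by omega⟩
  have hkt : k ≤ t := hkl.trans hlt.le
  let θ₀ : (Fin n × ℕ →₀ ℕ) → (Fin n × ℕ →₀ ℕ) := fun m =>
    m.equivMapDomain (Equiv.prodCongr (Equiv.refl _) (shiftPerm k t hkt))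
  let θ : (Fin n × ℕ →₀ ℕ) → (Fin n × ℕ →₀ ℕ) := fun m =>
    θ₀ m + colEmb k (colExp (θ₀ m) (l + 1))
  have hθ₀ : ∀ m j, colExp (θ₀ m) j = colExp m ((shiftPerm k t hkt).symm j) := fun _ _ => rfl
  have hθ : ∀ m₁ : Fin n × ℕ →₀ ℕ, (∀ j ≥ t, colExp m₁ j = 0) → ∀ j, colExp (θ m₁) j =
      if j < k then colExp m₁ j else if j = k then colExp m₁ l else colExp m₁ (j - 1) := by
    intro m₁ h j
    have hl : (shiftPerm k t hkt).symm (l + 1) = l := by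
      simp only [shiftPerm, Equiv.coe_fn_symm_mk]
      split_ifs <;> omega
    simp only [θ, colExp_add, colExp_colEmb, hθ₀, hl]
    simp only [shiftPerm, Equiv.coe_fn_symm_mk]
    split_ifs <;> first | omega | simp [h]
    rw [h _ (by omega), h _ (by omega)]
  refine Reach.of_map ((psiMap K n k (l + 1)).toLinearMap ∘ₗ
    (colPerm K n (shiftPerm k t hkt)).toLinearMap) θ (fun m₁ c => ?_) (fun N hN f hf => ?_) ?_ ?_
  · simp only [LinearMap.comp_apply, AlgHom.toLinearMap_apply, colPerm_monomial, psiMap_monomial]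
    rfl
  · exact hN.2 _ _ (by omega) _ (hN.1 _ _ hf)
  · exact ext_colExp fun j => by rw [hθ m ht, hm']
  · intro m₁ h
    have h₁ := hθ m₁ (h.colExp_eq_zero ht)
    obtain ⟨p, hp, hlt⟩ := h
    by_cases hpk : p < k
    · refine ⟨p, fun j hj => ?_, by simpa [h₁, hm', hpk] using hlt⟩
      rw [h₁, hm']
      split_ifs
      · exact hp _ hj
      · exact hp _ (by omega)
      · exact hp _ (by omega)
    · refine ⟨p + 1, fun j hj => ?_, ?_⟩
      · rw [h₁, hm', if_neg (by omega), if_neg (by omega), if_neg (by omega), if_neg (by omega)]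
        exact hp _ (by omega)
      · rw [h₁, hm', if_neg (by omega), if_neg (by omega), if_neg (by omega), if_neg (by omega)]
        exact hlt

lemma MonLt.add_indCol {m₁ m : Fin n × ℕ →₀ ℕ} {j : ℕ} {S T : Finset (Fin n)}
    (hcard : T.card = S.card)
    (htop : ∀ i ∉ S, ∀ i' ∈ S, entryCode (colExp m j) i < entryCode (colExp m j) i')
    (hm : m₁ = m ∧ T ≠ S ∨ MonLt m₁ m) :
    MonLt (m₁ + colEmb j (indCol T)) (m + colEmb j (indCol S)) := by
  rcases hm with ⟨rfl, hTS⟩ | ⟨p, hp, hlt⟩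
  · refine ⟨j, fun q hq => by simp [colExp_colEmb, hq.ne'], ?_⟩
    simpa [colExp_colEmb] using colVal_add_indCol_lt hcard htop le_rfl fun h => absurd h hTS
  · rcases lt_trichotomy p j with hpj | rfl | hpj
    · by_cases hTS : T = S
      · subst hTS
        exact ⟨p, fun q hq => by simp [hp q hq], by simpa [colExp_colEmb, hpj.ne] using hlt⟩
      · refine ⟨j, fun q hq => by simp [colExp_colEmb, hq.ne', hp q (hpj.trans hq)], ?_⟩
        simpa [colExp_colEmb] using
          colVal_add_indCol_lt hcard htop (hp j hpj ▸ le_rfl) fun h => absurd h hTS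
    · refine ⟨p, fun q hq => by simp [colExp_colEmb, hq.ne', hp q hq], ?_⟩
      simpa [colExp_colEmb] using
        colVal_add_indCol_lt hcard htop hlt.le fun _ h => hlt.ne (congrArg colVal h)
    · exact ⟨p, fun q hq => by simp [colExp_colEmb, (hpj.trans hq).ne', hp q hq],
        by simpa [colExp_colEmb, hpj.ne'] using hlt⟩

variable (K n) in
/-- The elementary symmetric polynomial of degree `d` in the variables of column `j`. -/
noncomputable def colEsymm (d j : ℕ) : MvPolynomial (Fin n × ℕ) K :=
  rename (fun i => (i, j)) (esymm (Fin n) K d)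

lemma colEsymm_mem_symAlg (d j : ℕ) : colEsymm K n d j ∈ symAlg K n := by
  intro τ
  rw [colEsymm, rowPerm, rename_rename]
  conv_rhs => rw [← rename_esymm (Fin n) K d τ, rename_rename]
  rfl

lemma colEsymm_eq_sum (d j : ℕ) : colEsymm K n d j =
    ∑ T ∈ Finset.powersetCard d Finset.univ, monomial (colEmb j (indCol T)) 1 := by
  classical
  rw [colEsymm, esymm_eq_sum_monomial, map_sum]
  refine Finset.sum_congr rfl fun T _ => ?_
  rw [rename_monomial, Finsupp.mapDomain_finsetSum, colEmb]
  congr 1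
  simp only [Finsupp.mapDomain_single, indCol, apply_ite (Finsupp.single _), Finsupp.single_zero]
  simp [Finset.sum_ite_mem]

/-- Increasing the top entries of a column by `1`. -/
lemma Reach.add_indCol {m : Fin n × ℕ →₀ ℕ} {j : ℕ} {S : Finset (Fin n)}
    (htop : ∀ i ∉ S, ∀ i' ∈ S, entryCode (colExp m j) i < entryCode (colExp m j) i') :
    Reach K m (m + colEmb j (indCol S)) := by
  classical
  intro N hN
  have hmul : ∀ m₁ (c : K), colEsymm K n S.card j * monomial m₁ c =
      ∑ T ∈ Finset.powersetCard S.card Finset.univ, monomial (m₁ + colEmb j (indCol T)) c := by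
    intro m₁ c
    rw [colEsymm_eq_sum, Finset.sum_mul]
    refine Finset.sum_congr rfl fun T _ => ?_
    rw [monomial_mul, one_mul, add_comm]
  refine leadIdeal_le_of_map (LinearMap.mulLeft K (colEsymm K n S.card j))
    (fun f hf => N.smul_mem ⟨_, colEsymm_mem_symAlg S.card j⟩ hf) (fun c => ?_) fun m₁ h c => ?_
  · rw [LinearMap.mulLeft_apply, hmul,
      ← Finset.sum_erase_add _ _ (Finset.mem_powersetCard.2 ⟨Finset.subset_univ S, rfl⟩),
      add_sub_cancel_right]
    refine Submodule.sum_mem _ fun T hT => monomial_mem_lowPoly ?_ c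
    obtain ⟨hTS, hT⟩ := Finset.mem_erase.1 hT
    exact MonLt.add_indCol (Finset.mem_powersetCard.1 hT).2 htop (.inl ⟨rfl, hTS⟩)
  · rw [LinearMap.mulLeft_apply, hmul]
    refine Submodule.sum_mem _ fun T hT => monomial_mem_lowPoly ?_ c
    exact MonLt.add_indCol (Finset.mem_powersetCard.1 hT).2 htop (.inr h)

lemma Reach.add_colEmb {m : Fin n × ℕ →₀ ℕ} {j : ℕ} (δ : Fin n → ℕ)
    (hδ : ∀ i i', entryCode (colExp m j) i < entryCode (colExp m j) i' → δ i ≤ δ i') :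
    Reach K m (m + colEmb j δ) := by
  classical
  induction hs : ∑ i, δ i using Nat.strong_induction_on generalizing m δ with
  | _ s ih =>
    subst hs
    by_cases h0 : δ = 0
    · rw [h0, colEmb_zero, add_zero]
      exact Reach.refl m
    set S : Finset (Fin n) := {i | 0 < δ i} with hS
    have hadd : indCol S + (δ - indCol S) = δ := by
      ext i
      simp only [Pi.add_apply, Pi.sub_apply, indCol, hS, Finset.mem_filter, Finset.mem_univ,
        true_and]
      split_ifs <;> omega
    have htop : ∀ i ∉ S, ∀ i' ∈ S, entryCode (colExp m j) i < entryCode (colExp m j) i' := by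
      intro i hi i' hi'
      by_contra! hle
      simp only [hS, Finset.mem_filter, Finset.mem_univ, true_and] at hi hi'
      have hlt := hle.lt_of_ne fun h => by
        obtain rfl := entryCode_injective _ h
        exact hi hi'
      have := hδ _ _ hlt
      omega
    refine (Reach.add_indCol htop).trans ?_
    rw [← hadd, colEmb_add, ← add_assoc]
    refine ih _ ?_ _ (fun i i' h => ?_) rfl
    · obtain ⟨i, hi⟩ := Function.ne_iff.1 h0
      refine Finset.sum_lt_sum (fun i _ => Nat.sub_le _ _) ⟨i, Finset.mem_univ i, ?_⟩
      have : 0 < δ i := Nat.pos_of_ne_zero hi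
      simp [indCol, hS, this]
    · by_contra! hlt
      simp only [Pi.sub_apply, indCol, hS, Finset.mem_filter, Finset.mem_univ, true_and] at hlt
      have hi : 0 < δ i := by omega
      have hii : δ i' < δ i := by split_ifs at hlt <;> omega
      have hlt' : entryCode (colExp m j) i' < entryCode (colExp m j) i := by
        refine lt_of_not_ge fun hle => ?_
        rcases hle.lt_or_eq with hlt' | heq
        · exact (hδ _ _ hlt').not_gt hii
        · obtain rfl := entryCode_injective _ heq
          exact hii.false
      refine h.not_ge ?_
      simp only [colExp_add, colExp_colEmb, if_true, entryCode, Pi.add_apply, indCol, hS,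
        Finset.mem_filter, Finset.mem_univ, true_and, hi] at hlt' ⊢
      split_ifs
      · rw [mul_add, mul_add]
        omega
      · rw [mul_add, mul_add]
        omega

/-- The order of the entries of `γ` agrees with that of `γ'`, and the entries as well as their
differences grow from `γ` to `γ'`. -/
def ColLe (γ γ' : Fin n → ℕ) : Prop :=
  (∀ i i', entryCode γ i < entryCode γ i' ↔ entryCode γ' i < entryCode γ' i') ∧
    (∀ i, γ i ≤ γ' i) ∧ ∀ i i', γ i' - γ i ≤ γ' i' - γ' i

instance ColLe.isPreorder : IsPreorder (Fin n → ℕ) ColLe where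
  refl _ := ⟨fun _ _ => Iff.rfl, fun _ => le_rfl, fun _ _ => le_rfl⟩
  trans _ _ _ h h' := ⟨fun i i' => (h.1 i i').trans (h'.1 i i'),
    fun i => (h.2.1 i).trans (h'.2.1 i), fun i i' => (h.2.2 i i').trans (h'.2.2 i i')⟩

lemma ColLe.wellQuasiOrdered_smythRel : WellQuasiOrdered (SmythRel (ColLe (n := n))) := by
  let e := Fintype.equivFin (Fin n ⊕ Fin n × Fin n)
  refine (wellQuasiOrdered_smythRel_prod_fin (Fin n → Fin n → Prop) _).smythRel_of_reflects
    (fun γ => (fun i i' => entryCode γ i < entryCode γ i',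
      fun a => Sum.elim γ (fun q => γ q.2 - γ q.1) (e.symm a))) ?_
  rintro γ γ' ⟨h, h'⟩
  refine ⟨fun i i' => iff_of_eq (congrFun₂ h i i'), fun i => ?_, fun i i' => ?_⟩
  · simpa using h' (e (.inl i))
  · simpa using h' (e (.inr (i, i')))

lemma Reach.of_colLe {m m' : Fin n × ℕ →₀ ℕ} {j : ℕ} (h : ColLe (colExp m j) (colExp m' j))
    (hm' : ∀ j' ≠ j, colExp m' j' = colExp m j') : Reach K m m' := by
  have : m' = m + colEmb j (colExp m' j - colExp m j) := by
    refine ext_colExp fun j' => ?_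
    by_cases hj : j' = j
    · subst hj
      ext i
      have := h.2.1 i
      simp [colExp_colEmb, this]
    · simp [colExp_colEmb, hj, hm' j' hj]
  rw [this]
  refine Reach.add_colEmb _ fun i i' hlt => ?_
  have h₁ := le_of_entryCode_lt hlt
  have h₂ := le_of_entryCode_lt ((h.1 i i').1 hlt)
  have h₃ := h.2.2 i i'
  have h₄ := h.2.1 i
  simp only [Pi.sub_apply]
  omega

/-- The monomial whose columns are listed by `w`, starting with the column of highest index. -/
noncomputable def listMon : List (Fin n → ℕ) → (Fin n × ℕ →₀ ℕ)
  | [] => 0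
  | γ :: w => colEmb w.length γ + listMon w

lemma colExp_listMon (w : List (Fin n → ℕ)) (j : ℕ) :
    colExp (listMon w) j = w.reverse.getD j 0 := by
  induction w with
  | nil => rfl
  | cons γ w ih =>
    rw [listMon, colExp_add, colExp_colEmb, ih, List.reverse_cons]
    rcases lt_trichotomy j w.length with h | rfl | h
    · rw [List.getD_append _ _ _ _ (by simpa using h), if_neg h.ne, zero_add]
    · simp
    · rw [if_neg h.ne', zero_add, List.getD_eq_default _ _ (by simpa using h.le),
        List.getD_eq_default _ _ (by simpa using h)]

lemma colExp_listMon_append (p w : List (Fin n → ℕ)) (j : ℕ) :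
    colExp (listMon (p ++ w)) j =
      if j < w.length then colExp (listMon w) j else colExp (listMon p) (j - w.length) := by
  simp only [colExp_listMon, List.reverse_append]
  split_ifs with h
  · exact List.getD_append _ _ _ _ (by simpa using h)
  · rw [List.getD_append_right _ _ _ _ (by simpa using h), List.length_reverse]

lemma listMon_surjective : Function.Surjective (listMon (n := n)) := by
  intro m
  obtain ⟨t, ht⟩ := exists_forall_colExp_eq_zero m
  refine ⟨((List.range t).map (colExp m)).reverse, ext_colExp fun j => ?_⟩
  rw [colExp_listMon, List.reverse_reverse]
  by_cases hj : j < t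
  · simp [List.getD_eq_getElem?_getD, hj]
  · rw [List.getD_eq_default _ _ (by simpa using hj), ht j (not_lt.1 hj)]

lemma Reach.listMon_dup {p w : List (Fin n → ℕ)} {a : Fin n → ℕ} (ha : a ∈ p) :
    Reach K (listMon (p ++ w)) (listMon (p ++ a :: w)) := by
  obtain ⟨q, hq, hqa⟩ := List.getElem_of_mem (List.mem_reverse.2 ha)
  have hqa' : colExp (listMon p) q = a := by
    rw [colExp_listMon, List.getD_eq_getElem _ _ hq, hqa]
  have hone : colExp (listMon [a]) 0 = a := by simp [colExp_listMon]
  refine Reach.dup (k := w.length) (l := w.length + q) (Nat.le_add_right _ _) fun j => ?_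
  rw [List.append_cons, colExp_listMon_append _ w]
  split_ifs with h h'
  · rw [colExp_listMon_append, if_pos h]
  · rw [colExp_listMon_append _ w, if_neg (by omega), Nat.add_sub_cancel_left, hqa', h',
      Nat.sub_self, colExp_listMon_append, if_pos (by simp), hone]
  · rw [colExp_listMon_append, if_neg (by simp; omega), colExp_listMon_append, if_neg (by omega),
      List.length_singleton, Nat.sub_right_comm]

lemma Reach.listMon_forall₂ {u w : List (Fin n → ℕ)} (h : List.Forall₂ ColLe u w)
    (p : List (Fin n → ℕ)) : Reach K (listMon (p ++ u)) (listMon (p ++ w)) := by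
  induction h generalizing p with
  | nil => exact Reach.refl _
  | @cons a b u w hab _ ih =>
    refine Reach.trans ?_ (List.append_cons p b w ▸ List.append_cons p b u ▸ ih (p ++ [b]))
    have hone : ∀ a : Fin n → ℕ, colExp (listMon [a]) 0 = a := by simp [colExp_listMon]
    have hcol : ∀ a : Fin n → ℕ, colExp (listMon (p ++ a :: u)) u.length = a := fun a => by
      rw [List.append_cons, colExp_listMon_append, if_neg (lt_irrefl _), Nat.sub_self,
        colExp_listMon_append, if_pos (by simp), hone]
    refine Reach.of_colLe (j := u.length) (by rwa [hcol, hcol]) fun j hj => ?_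
    rw [List.append_cons, List.append_cons p a, colExp_listMon_append, colExp_listMon_append _ u]
    split_ifs with h
    · rfl
    · rw [colExp_listMon_append, colExp_listMon_append, List.length_singleton,
        List.length_singleton, if_neg (by omega), if_neg (by omega)]

lemma CoveredEmb.exists_reach {s : Set (Fin n → ℕ)} {w w' : List (Fin n → ℕ)}
    (h : CoveredEmb ColLe s w w') (p : List (Fin n → ℕ)) (hp : ∀ x ∈ s, x ∈ p) :
    ∃ u, List.Forall₂ ColLe u w' ∧ Reach K (listMon (p ++ w)) (listMon (p ++ u)) := by
  induction h generalizing p with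
  | nil s => exact ⟨[], .nil, Reach.refl _⟩
  | @hit s a b w w' hab _ ih =>
    obtain ⟨u, hu, hr⟩ := ih (p ++ [a]) (by
      rintro x (rfl | hx)
      · simp
      · simp [hp x hx])
    refine ⟨a :: u, .cons hab hu, ?_⟩
    rwa [List.append_cons, List.append_cons p a u]
  | @skip s a b w w' ha hab _ ih =>
    obtain ⟨u, hu, hr⟩ := ih (p ++ [a]) fun x hx => by simp [hp x hx]
    refine ⟨a :: u, .cons hab hu, (Reach.listMon_dup (hp a ha)).trans ?_⟩
    rwa [List.append_cons, List.append_cons p a u]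

instance Reach.isPreorder : IsPreorder (Fin n × ℕ →₀ ℕ) (Reach K) where
  refl := Reach.refl
  trans _ _ _ := Reach.trans

lemma Reach.wellQuasiOrdered : WellQuasiOrdered (Reach K (n := n)) := by
  intro f
  choose w hw using fun k => listMon_surjective (f k)
  obtain ⟨i, j, hij, h⟩ := wellQuasiOrdered_coveredEmb ColLe.wellQuasiOrdered_smythRel w
  obtain ⟨u, hu, hr⟩ := h.exists_reach (K := K) [] (by simp)
  have := hr.trans (Reach.listMon_forall₂ hu [])
  rw [List.nil_append, List.nil_append, hw, hw] at this
  exact ⟨i, j, hij, this⟩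

lemma Reach.wellQuasiOrdered_leadIdeal_eq [IsNoetherianRing K]
    {M : Submodule (symAlg K n) (MvPolynomial (Fin n × ℕ) K)} (hM : IsColClosed M) :
    WellQuasiOrdered fun m m' => Reach K m m' ∧ leadIdeal M m = leadIdeal M m' := by
  intro f
  obtain ⟨g, hg⟩ := Reach.wellQuasiOrdered (K := K).exists_monotone_subseq f
  obtain ⟨k, hk⟩ := monotone_stabilizes_iff_noetherian.2 ‹IsNoetherianRing K›
    ⟨fun k => leadIdeal M (f (g k)), fun i j hij => hg i j hij M hM⟩
  exact ⟨g k, g (k + 1), g.strictMono k.lt_succ_self, hg _ _ k.le_succ, hk _ k.le_succ⟩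

lemma exists_sub_monomial_mem_lowPoly {f : MvPolynomial (Fin n × ℕ) K} (hf : f ≠ 0) :
    ∃ m ∈ f.support, f - monomial m (coeff m f) ∈ lowPoly K m := by
  classical
  obtain ⟨m, hm, hmax⟩ := MonLt.exists_max f.support (support_nonempty.2 hf)
  refine ⟨m, hm, ?_⟩
  rw [lowPoly, mem_restrictSupport_iff]
  intro m' hm'
  rw [Finset.mem_coe, mem_support_iff, coeff_sub, coeff_monomial] at hm'
  rcases eq_or_ne m m' with rfl | hne
  · simp at hm'
  · rw [if_neg hne, sub_zero] at hm'
    exact hmax m' (mem_support_iff.2 hm') hne.symm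

/-- A submodule contained in another one with the same leading coefficients is equal to it. -/
lemma le_of_leadIdeal_le {M N : Submodule (symAlg K n) (MvPolynomial (Fin n × ℕ) K)}
    (hNM : N ≤ M) (h : ∀ m, leadIdeal M m ≤ leadIdeal N m) : M ≤ N := by
  have key : ∀ m c f, f ∈ M → f - monomial m c ∈ lowPoly K m → f ∈ N := by
    intro m
    induction m using (MonLt.wellFounded n).induction with
    | _ m ih =>
      intro c f hf hfm
      have hc : c ∈ leadIdeal M m := ⟨_, hfm, by simpa using hf⟩
      obtain ⟨g, hg, hgN⟩ := h m hc
      have hlow : f - (monomial m c + g) ∈ lowPoly K m := by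
        rw [← sub_sub]
        exact sub_mem hfm hg
      suffices f - (monomial m c + g) ∈ N by simpa using add_mem this hgN
      by_cases h0 : f - (monomial m c + g) = 0
      · rw [h0]
        exact zero_mem _
      obtain ⟨m', hm', hlow'⟩ := exists_sub_monomial_mem_lowPoly h0
      rw [lowPoly, mem_restrictSupport_iff] at hlow
      exact ih m' (hlow hm') _ _ (sub_mem hf (hNM hgN)) hlow'
  intro f hf
  by_cases h0 : f = 0
  · rw [h0]
    exact zero_mem _
  obtain ⟨m, -, hm⟩ := exists_sub_monomial_mem_lowPoly h0
  exact key m _ f hf hm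

lemma IsColClosed.exists_finset_generators [IsNoetherianRing K]
    {M : Submodule (symAlg K n) (MvPolynomial (Fin n × ℕ) K)} (hM : IsColClosed M) :
    ∃ B : Finset (MvPolynomial (Fin n × ℕ) K), (∀ f ∈ B, f ∈ M) ∧
      ∀ N : Submodule (symAlg K n) (MvPolynomial (Fin n × ℕ) K),
        (∀ f ∈ B, f ∈ N) → IsColClosed N → M ≤ N := by
  classical
  obtain ⟨F, -, hF⟩ := (Reach.wellQuasiOrdered_leadIdeal_eq hM).exists_finset_basis Set.univ
  choose G hG using fun m => (isNoetherianRing_iff_ideal_fg K).1 ‹_› (leadIdeal M m)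
  have hGM : ∀ m, ∀ c ∈ G m, ∃ f ∈ lowPoly K m, monomial m c + f ∈ M := fun m c hc =>
    mem_leadIdeal.1 (hG m ▸ Ideal.subset_span hc)
  choose! q hq hqM using hGM
  refine ⟨F.biUnion fun m => (G m).image fun c => monomial m c + q m c, ?_, fun N hBN hN => ?_⟩
  · intro f hf
    simp only [Finset.mem_biUnion, Finset.mem_image] at hf
    obtain ⟨m, -, c, hc, rfl⟩ := hf
    exact hqM m c hc
  · have hNM : IsColClosed (N ⊓ M) :=
      ⟨fun σ f hf => ⟨hN.1 σ f hf.1, hM.1 σ f hf.2⟩,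
        fun k l hkl f hf => ⟨hN.2 k l hkl f hf.1, hM.2 k l hkl f hf.2⟩⟩
    refine (le_of_leadIdeal_le inf_le_right fun m => ?_).trans inf_le_left
    obtain ⟨m₀, hm₀, hr, heq⟩ := hF m trivial
    rw [← heq]
    refine le_trans ?_ (hr _ hNM)
    rw [← hG m₀]
    refine Ideal.span_le.2 fun c hc => ⟨q m₀ c, hq m₀ c hc, hBN _ ?_, hqM m₀ c hc⟩
    simp only [Finset.mem_biUnion, Finset.mem_image]
    exact ⟨m₀, hm₀, c, hc, rfl⟩

end LeadingCoefficients

/-- Krasilnikov, 1989. Over a Noetherian commutative ring `K`, every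
`Sym(ℕ)`-invariant `Ψ`-closed `R̄_n`-submodule of `R_n` is finitely generated as a
`Sym(ℕ)`-invariant `Ψ`-closed `R̄_n`-submodule: it is the smallest `R̄_n`-submodule
containing some finite set `B` that is closed under all `σ ∈ Sym(ℕ)` and all `ψ ∈ Ψ`. -/
theorem symInvariant_psiClosed_submodule_fg
    (K : Type) [CommRing K] [IsNoetherianRing K] (n : ℕ) (hn : 1 ≤ n)
    (M : Submodule (symAlg K n) (MvPolynomial (Fin n × ℕ) K))
    (hsym : ∀ σ : Equiv.Perm ℕ, (colPerm K n σ) '' (M : Set (MvPolynomial (Fin n × ℕ) K)) = M)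
    (hpsi : ∀ k l : ℕ, k ≠ l → ∀ f ∈ M, psiMap K n k l f ∈ M) :
    ∃ B : Finset (MvPolynomial (Fin n × ℕ) K), (↑B : Set (MvPolynomial (Fin n × ℕ) K)) ⊆ M ∧
      M = sInf {M' : Submodule (symAlg K n) (MvPolynomial (Fin n × ℕ) K) |
        (↑B : Set (MvPolynomial (Fin n × ℕ) K)) ⊆ M' ∧
        (∀ σ : Equiv.Perm ℕ, ∀ f ∈ M', colPerm K n σ f ∈ M') ∧
        (∀ k l : ℕ, k ≠ l → ∀ f ∈ M', psiMap K n k l f ∈ M')} := by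

  have hM : IsColClosed M :=
    ⟨fun σ f hf => by
      have : colPerm K n σ f ∈ (colPerm K n σ) '' (M : Set (MvPolynomial (Fin n × ℕ) K)) :=
        ⟨f, hf, rfl⟩
      rwa [hsym σ] at this, hpsi⟩
  obtain ⟨B, hBM, hB⟩ := hM.exists_finset_generators
  refine ⟨B, hBM, le_antisymm (le_sInf ?_) (sInf_le ⟨hBM, hM.1, hM.2⟩)⟩
  rintro N ⟨hBN, hN⟩
  exact hB N hBN hN
end
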